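/- arXiv:2404.09306 — 3 statements merged into one kernel-verified Lean document; each statement's English description precedes it below -/
import Mathlib

section
/- Let (σ_n) be a bounded sequence of positive real numbers, a, M > 0. In the shuffled regression model, suppose the error δ is centered with E δ² < ∞ and the covariate distribution μ_X on [0,1] has a density bounded below by a known constant c_X > 0 on its support. Then there exists K > 0, not depending on n, such that for every n ≥ 1 the empirical shuffled minimax risk satisfies R_S(M,a,n,μ̂_X) ≤ K·σ_n. -/
open MeasureTheory ProbabilityTheory Filter Set
open scoped ENNReal NNReal Classical

noncomputable section

/-- The class of nondecreasing functions on `[0,1]` that are left-continuous with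
right-hand limits at every point (LCRR). -/
def LCRR : Set (ℝ → ℝ) :=
  {m | MonotoneOn m (Icc 0 1) ∧
    (∀ x ∈ Ioc (0 : ℝ) 1, Tendsto m (nhdsWithin x (Iio x)) (nhds (m x))) ∧
    (∀ x ∈ Ico (0 : ℝ) 1, ∃ L : ℝ, Tendsto m (nhdsWithin x (Ioi x)) (nhds L))}

/-- The class `M(M, a)` of LCRR nondecreasing functions with `∫ |m|^(a+2) dμ_X ≤ M`. -/
def MM (μX : Measure ℝ) (M a : ℝ) : Set (ℝ → ℝ) :=
  {m | m ∈ LCRR ∧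
    ∫⁻ x, ENNReal.ofReal (|m x| ^ (a + 2)) ∂μX ≤ ENNReal.ofReal M}

/-- The law of the observations in the shuffled regression model: from i.i.d. pairs
`(Xᵢ, δᵢ)`, one observes the vector `(Y₁,…,Yₙ)` with `Yᵢ = m(Xᵢ) + σ δᵢ` together with
the order statistics `X₍₁₎ ≤ … ≤ X₍ₙ₎` of the `Xᵢ`'s. -/
def shuffledLaw (μX μδ : Measure ℝ) (σ : ℝ) (m : ℝ → ℝ) (n : ℕ) :
    Measure ((Fin n → ℝ) × (Fin n → ℝ)) :=
  (Measure.pi fun _ : Fin n => μX.prod μδ).map fun ω =>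
    (fun i => m (ω i).1 + σ * (ω i).2,
     fun j => (ω (Tuple.sort (fun i => (ω i).1) j)).1)

/-- The population risk `E_m ∫ |m̂ - m| dμ_X` of an estimator `m̂` of the link function
in the shuffled regression model. -/
def popRisk (μX : Measure ℝ) {n : ℕ}
    (P : Measure ((Fin n → ℝ) × (Fin n → ℝ)))
    (mhat : ((Fin n → ℝ) × (Fin n → ℝ)) → ℝ → ℝ) (m : ℝ → ℝ) : ℝ≥0∞ :=
  ∫⁻ d, ∫⁻ x, ENNReal.ofReal |mhat d x - m x| ∂μX ∂P

/-- The empirical risk `E_m ∫ |m̂ - m| dμ̂_X` in the shuffled regression model, where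
`μ̂_X` is the empirical distribution of the `Xᵢ`'s (recovered from the order
statistics, the second observed component). -/
def empRisk {n : ℕ}
    (P : Measure ((Fin n → ℝ) × (Fin n → ℝ)))
    (mhat : ((Fin n → ℝ) × (Fin n → ℝ)) → ℝ → ℝ) (m : ℝ → ℝ) : ℝ≥0∞ :=
  ∫⁻ d, (n : ℝ≥0∞)⁻¹ *
    ∑ i : Fin n, ENNReal.ofReal |mhat d (d.2 i) - m (d.2 i)| ∂P

/-- Number of design points strictly to the left of `x`. -/
def cnt {n : ℕ} (z : Fin n → ℝ) (x : ℝ) : ℕ :=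
  ∑ j : Fin n, if z j < x then 1 else 0

/-- The `c`-th smallest response (with `c` truncated to the admissible range). -/
def sortAt {n : ℕ} (hn : 0 < n) (y : Fin n → ℝ) (c : ℕ) : ℝ :=
  y (Tuple.sort y ⟨min c (n - 1), by omega⟩)

/-- The estimator: match sorted responses with sorted covariates. -/
def est {n : ℕ} (hn : 0 < n) (d : (Fin n → ℝ) × (Fin n → ℝ)) (x : ℝ) : ℝ :=
  sortAt hn d.1 (cnt d.2 x)

lemma cnt_mono {n : ℕ} (z : Fin n → ℝ) : Monotone (cnt z) := by
  intro x y hxy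
  unfold cnt
  refine Finset.sum_le_sum fun j _ => ?_
  split_ifs with h1 h2 <;> first | omega | exact absurd (h1.trans_le hxy) h2

lemma cnt_left {n : ℕ} (z : Fin n → ℝ) (x : ℝ) :
    ∀ᶠ y in nhdsWithin x (Iio x), cnt z y = cnt z x := by
  have h : ∀ j : Fin n, ∀ᶠ y in nhdsWithin x (Iio x), (z j < y ↔ z j < x) := by
    intro j
    by_cases hj : z j < x
    · filter_upwards [mem_nhdsWithin_of_mem_nhds (lt_mem_nhds hj)] with y hy
      exact ⟨fun _ => hj, fun _ => hy⟩
    · filter_upwards [self_mem_nhdsWithin] with y hy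
      exact ⟨fun h => h.trans hy, fun h => absurd h hj⟩
  filter_upwards [eventually_all.2 h] with y hy
  unfold cnt
  refine Finset.sum_congr rfl fun j _ => ?_
  simp only [hy j]

lemma cnt_right {n : ℕ} (z : Fin n → ℝ) (x : ℝ) :
    ∃ c : ℕ, ∀ᶠ y in nhdsWithin x (Ioi x), cnt z y = c := by
  have h : ∀ j : Fin n, ∀ᶠ y in nhdsWithin x (Ioi x), (z j < y ↔ z j ≤ x) := by
    intro j
    by_cases hj : z j ≤ x
    · filter_upwards [self_mem_nhdsWithin] with y hy
      exact ⟨fun _ => hj, fun _ => hj.trans_lt hy⟩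
    · filter_upwards [mem_nhdsWithin_of_mem_nhds (gt_mem_nhds (not_le.1 hj))] with y hy
      exact ⟨fun h => absurd (h.trans hy) (lt_irrefl _), fun h => absurd h hj⟩
  refine ⟨∑ j : Fin n, if z j ≤ x then 1 else 0, ?_⟩
  filter_upwards [eventually_all.2 h] with y hy
  unfold cnt
  refine Finset.sum_congr rfl fun j _ => ?_
  simp only [hy j]

lemma est_LCRR {n : ℕ} (hn : 0 < n) (d : (Fin n → ℝ) × (Fin n → ℝ)) : est hn d ∈ LCRR := by
  refine ⟨?_, ?_, ?_⟩
  · intro x _ y _ hxy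
    refine Tuple.monotone_sort d.1 ?_
    rw [Fin.mk_le_mk]
    exact min_le_min_right _ (cnt_mono d.2 hxy)
  · intro x _
    refine tendsto_const_nhds.congr' ?_
    filter_upwards [cnt_left d.2 x] with y hy
    simp only [est, hy]
  · intro x _
    obtain ⟨c, hc⟩ := cnt_right d.2 x
    refine ⟨sortAt hn d.1 c, tendsto_const_nhds.congr' ?_⟩
    filter_upwards [hc] with y hy
    simp only [est, hy]

lemma measurable_sorted {n : ℕ} (i : Fin n) :
    Measurable (fun y : Fin n → ℝ => y (Tuple.sort y i)) := by
  have hs : ∀ τ : Equiv.Perm (Fin n), MeasurableSet {y : Fin n → ℝ | τ = Tuple.sort y} := by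
    intro τ
    have : {y : Fin n → ℝ | τ = Tuple.sort y} =
        {y | (∀ i j, i ≤ j → y (τ i) ≤ y (τ j)) ∧
          ∀ i j, i < j → y (τ i) = y (τ j) → τ i < τ j} := by
      ext y
      exact Tuple.eq_sort_iff
    have e : ∀ i : Fin n, Measurable (fun y : Fin n → ℝ => y i) := fun i => measurable_pi_apply i
    have e2 : {y : Fin n → ℝ | τ = Tuple.sort y} =
        (⋂ i, ⋂ j, ⋂ (_ : i ≤ j), {y : Fin n → ℝ | y (τ i) ≤ y (τ j)}) ∩
        ⋂ i, ⋂ j, ⋂ (_ : i < j),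
          ({y : Fin n → ℝ | y (τ i) = y (τ j)}ᶜ ∪ {_y | τ i < τ j}) := by
      rw [this]
      ext y
      simp [imp_iff_not_or]
    rw [e2]
    refine MeasurableSet.inter ?_ ?_
    · exact MeasurableSet.iInter fun i => MeasurableSet.iInter fun j =>
        MeasurableSet.iInter fun _ => measurableSet_le (e _) (e _)
    · exact MeasurableSet.iInter fun i => MeasurableSet.iInter fun j =>
        MeasurableSet.iInter fun _ =>
          (measurableSet_eq_fun (e _) (e _)).compl.union (MeasurableSet.const _)
  have : (fun y : Fin n → ℝ => y (Tuple.sort y i)) =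
      fun y => ∑ τ : Equiv.Perm (Fin n), if τ = Tuple.sort y then y (τ i) else 0 := by
    ext y; simp
  rw [this]
  exact Finset.measurable_sum _ fun τ _ =>
    Measurable.ite (hs τ) (measurable_pi_apply _) measurable_const

lemma measurable_cnt {n : ℕ} :
    Measurable (fun q : (Fin n → ℝ) × ℝ => cnt q.1 q.2) := by
  unfold cnt
  refine Finset.measurable_sum _ fun j _ => ?_
  have hs : MeasurableSet {q : (Fin n → ℝ) × ℝ | q.1 j < q.2} :=
    measurableSet_lt ((measurable_pi_apply j).comp measurable_fst) measurable_snd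
  exact Measurable.ite hs measurable_const measurable_const

lemma measurable_sortAt {n : ℕ} (hn : 0 < n) :
    Measurable (fun q : (Fin n → ℝ) × ℕ => sortAt hn q.1 q.2) := by
  refine measurable_from_prod_countable_left fun c => ?_
  exact measurable_sorted (⟨min c (n - 1), by omega⟩ : Fin n)

lemma measurable_est {n : ℕ} (hn : 0 < n) :
    Measurable (fun p : ((Fin n → ℝ) × (Fin n → ℝ)) × ℝ => est hn p.1 p.2) := by
  have h1 : Measurable (fun p : ((Fin n → ℝ) × (Fin n → ℝ)) × ℝ => cnt p.1.2 p.2) :=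
    measurable_cnt.comp ((measurable_snd.comp measurable_fst).prodMk measurable_snd)
  have h2 : Measurable (fun p : ((Fin n → ℝ) × (Fin n → ℝ)) × ℝ => p.1.1) :=
    measurable_fst.comp measurable_fst
  have h3 : Measurable (fun p : ((Fin n → ℝ) × (Fin n → ℝ)) × ℝ => (p.1.1, cnt p.1.2 p.2)) :=
    h2.prodMk h1
  exact (measurable_sortAt hn).comp h3

lemma cnt_strictMono {n : ℕ} (z : Fin n → ℝ) (hz : StrictMono z) (i : Fin n) :
    cnt z (z i) = i := by
  unfold cnt
  simp only [hz.lt_iff_lt]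
  rw [Finset.sum_boole]
  have : (Finset.univ.filter fun j : Fin n => j < i) = Finset.Iio i := by
    ext j; simp
  rw [this]
  simp

lemma est_at {n : ℕ} (hn : 0 < n) (y z : Fin n → ℝ) (hz : StrictMono z) (i : Fin n) :
    est hn (y, z) (z i) = y (Tuple.sort y i) := by
  unfold est sortAt
  simp only [cnt_strictMono z hz i]
  congr 2
  ext
  simp
  omega

/-- One-dimensional optimal matching for the `L¹` cost. -/
lemma sum_abs_le {n : ℕ} (u w : Fin n → ℝ) (hu : Monotone u) (hw : Monotone w)
    (τ : Equiv.Perm (Fin n)) :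
    ∑ i, ENNReal.ofReal |u i - w i| ≤ ∑ i, ENNReal.ofReal |u i - w (τ i)| := by
  have key : ∀ a b : ℝ, ENNReal.ofReal |a - b| =
      ∫⁻ t, ENNReal.ofReal |(if t ≤ a then (1 : ℝ) else 0) - (if t ≤ b then 1 else 0)| := by
    intro a b
    rw [← Real.volume_uIoc, ← lintegral_indicator_one measurableSet_uIoc]
    refine lintegral_congr fun t => ?_
    simp only [indicator, mem_uIoc, Pi.one_apply]
    split_ifs <;> first | (simp; done) | (exfalso; grind)
  have hm : ∀ a b : ℝ, Measurable fun t : ℝ =>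
      ENNReal.ofReal |(if t ≤ a then (1 : ℝ) else 0) - (if t ≤ b then 1 else 0)| := by
    intro a b
    refine ENNReal.measurable_ofReal.comp (Measurable.abs (Measurable.sub ?_ ?_)) <;>
    exact Measurable.ite measurableSet_Iic measurable_const measurable_const
  rw [Finset.sum_congr rfl fun i _ => key (u i) (w i),
    Finset.sum_congr rfl fun i _ => key (u i) (w (τ i))]
  rw [← lintegral_finsetSum _ fun i _ => hm _ _, ← lintegral_finsetSum _ fun i _ => hm _ _]
  refine lintegral_mono fun t => ?_
  dsimp only
  rw [← ENNReal.ofReal_sum_of_nonneg fun i _ => abs_nonneg _,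
    ← ENNReal.ofReal_sum_of_nonneg fun i _ => abs_nonneg _]
  refine ENNReal.ofReal_le_ofReal ?_
  set U : Fin n → ℝ := fun i => if t ≤ u i then 1 else 0 with hU
  set W : Fin n → ℝ := fun i => if t ≤ w i then 1 else 0 with hW
  have hperm : ∑ i, W (τ i) = ∑ i, W i := Equiv.sum_comp τ W
  have hsign : (∀ i, W i ≤ U i) ∨ (∀ i, U i ≤ W i) := by
    by_contra! h
    obtain ⟨⟨i, hi⟩, ⟨j, hj⟩⟩ := h
    simp only [hU, hW] at hi hj
    have h1 : t ≤ w i ∧ ¬ t ≤ u i := by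
      split_ifs at hi <;> first | (norm_num at hi; done) | (constructor <;> assumption)
    have h2 : t ≤ u j ∧ ¬ t ≤ w j := by
      split_ifs at hj <;> first | (norm_num at hj; done) | (constructor <;> assumption)
    rcases le_total i j with hij | hij
    · exact h2.2 (h1.1.trans (hw hij))
    · exact h1.2 (h2.1.trans (hu hij))
  have habs : ∑ i, |U i - W i| = |∑ i, (U i - W i)| := by
    rcases hsign with h | h
    · rw [Finset.abs_sum_of_nonneg fun i _ => sub_nonneg.2 (h i)]
      exact Finset.sum_congr rfl fun i _ => abs_of_nonneg (sub_nonneg.2 (h i))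
    · rw [abs_of_nonpos (Finset.sum_nonpos fun i _ => sub_nonpos.2 (h i)),
        ← Finset.sum_neg_distrib]
      exact Finset.sum_congr rfl fun i _ => abs_of_nonpos (sub_nonpos.2 (h i))
  calc ∑ i, |U i - W i| = |∑ i, (U i - W i)| := habs
    _ = |∑ i, (U i - W (τ i))| := by
      rw [Finset.sum_sub_distrib, Finset.sum_sub_distrib, hperm]
    _ ≤ ∑ i, |U i - W (τ i)| := Finset.abs_sum_le_sum_abs _ _

/-- Deterministic bound on the empirical loss of the estimator. -/
lemma det_bound {n : ℕ} (hn : 0 < n) (x y : Fin n → ℝ) (m : ℝ → ℝ)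
    (hm : MonotoneOn m (Icc 0 1)) (hx : ∀ i, x i ∈ Icc (0 : ℝ) 1)
    (hinj : Function.Injective x) :
    ∑ i, ENNReal.ofReal |est hn (y, fun j => x (Tuple.sort x j)) (x (Tuple.sort x i))
        - m (x (Tuple.sort x i))| ≤ ∑ i, ENNReal.ofReal |y i - m (x i)| := by
  have hmono : Monotone (fun j => x (Tuple.sort x j)) := Tuple.monotone_sort x
  have hz : StrictMono (fun j => x (Tuple.sort x j)) :=
    hmono.strictMono_of_injective (hinj.comp (Tuple.sort x).injective)
  have h1 : ∀ i, est hn (y, fun j => x (Tuple.sort x j)) (x (Tuple.sort x i)) =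
      y (Tuple.sort y i) := fun i => est_at hn y _ hz i
  simp only [h1]
  refine (sum_abs_le (fun i => y (Tuple.sort y i)) (fun i => m (x (Tuple.sort x i)))
    (Tuple.monotone_sort y) (fun i j hij => hm (hx _) (hx _) (hmono hij))
    ((Tuple.sort y).trans (Tuple.sort x).symm)).trans ?_
  simp only [Equiv.trans_apply, Equiv.apply_symm_apply]
  exact (Equiv.sum_comp (Tuple.sort y) fun i => ENNReal.ofReal |y i - m (x i)|).le

lemma ae_distinct {n : ℕ} (μX μδ : Measure ℝ) [IsProbabilityMeasure μX]
    [IsProbabilityMeasure μδ] (hna : ∀ x, μX {x} = 0) :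
    ∀ᵐ ω ∂(Measure.pi fun _ : Fin n => μX.prod μδ),
      Function.Injective fun i => (ω i).1 := by
  have h : ∀ i j : Fin n, i ≠ j → ∀ᵐ ω ∂(Measure.pi fun _ : Fin n => μX.prod μδ),
      (ω i).1 ≠ (ω j).1 := by
    intro i j hij
    have hind := (iIndepFun_pi (μ := fun _ : Fin n => μX.prod μδ)
      (X := fun _ => (Prod.fst : ℝ × ℝ → ℝ)) fun _ => measurable_fst.aemeasurable).indepFun hij
    have hmap : ∀ k : Fin n, (Measure.pi fun _ : Fin n => μX.prod μδ).map
        (fun ω => (ω k).1) = μX := by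
      intro k
      exact (measurePreserving_fst.comp
        (measurePreserving_eval (fun _ : Fin n => μX.prod μδ) k)).map_eq
    have hjoint : (Measure.pi fun _ : Fin n => μX.prod μδ).map
        (fun ω => ((ω i).1, (ω j).1)) =
        ((Measure.pi fun _ : Fin n => μX.prod μδ).map (fun ω => (ω i).1)).prod
        ((Measure.pi fun _ : Fin n => μX.prod μδ).map (fun ω => (ω j).1)) := hind.map_prod_eq_prod_map_map
      (measurable_fst.comp (measurable_pi_apply i)).aemeasurable
      (measurable_fst.comp (measurable_pi_apply j)).aemeasurable
    rw [hmap, hmap] at hjoint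
    have hd : (μX.prod μX) {p : ℝ × ℝ | p.1 = p.2} = 0 := by
      rw [Measure.measure_prod_null (measurableSet_eq_fun measurable_fst measurable_snd)]
      refine Eventually.of_forall fun x => ?_
      have : Prod.mk x ⁻¹' {p : ℝ × ℝ | p.1 = p.2} = {x} := by
        ext y; simp [eq_comm]
      simp only [this, hna, Pi.zero_apply]
    rw [← hjoint, Measure.map_apply (by fun_prop)
      (measurableSet_eq_fun measurable_fst measurable_snd)] at hd
    rw [ae_iff]
    simpa using hd
  have h' := eventually_all.2 fun i => eventually_all.2 fun j => eventually_all.2 fun hij => h i j hij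
  filter_upwards [h'] with ω hω i j hij
  by_contra hne
  exact hω i j hne hij

lemma ae_mem {n : ℕ} (μX μδ : Measure ℝ) [IsProbabilityMeasure μX]
    [IsProbabilityMeasure μδ] (hs : μX (Icc 0 1) = 1) :
    ∀ᵐ ω ∂(Measure.pi fun _ : Fin n => μX.prod μδ), ∀ i, (ω i).1 ∈ Icc (0 : ℝ) 1 := by
  have h0 : ∀ᵐ x ∂μX, x ∈ Icc (0 : ℝ) 1 := by
    rw [← prob_compl_eq_zero_iff measurableSet_Icc] at hs
    exact hs
  refine eventually_all.2 fun i => ?_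
  exact (measurePreserving_fst.comp
    (measurePreserving_eval (fun _ : Fin n => μX.prod μδ) i)).quasiMeasurePreserving.ae h0

/-- **Upper bound on the empirical shuffled minimax risk** (Theorem 4.1, first claim).
If the error is centered with finite variance and the covariate density is bounded
below by a known `c_X > 0` on its support, then there is a constant `K > 0`, not
depending on `n`, such that for every `n ≥ 1` there is a monotone LCRR estimator whose
maximal empirical risk over `m ∈ M(M,a)` is at most `K σ_n`. -/
theorem shuffled_empirical_minimax_upper_bound
    (σ : ℕ → ℝ) (A : ℝ) (hσpos : ∀ n, 0 < σ n) (hσbdd : ∀ n, σ n ≤ A)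
    (a M : ℝ) (ha : 0 < a) (hM : 0 < M)
    (μδ : Measure ℝ) (hδprob : IsProbabilityMeasure μδ)
    (hmean : ∫ x, x ∂μδ = 0)
    (hvarfin : ∫⁻ x, ENNReal.ofReal (x ^ 2) ∂μδ < ⊤)
    (μX : Measure ℝ) (hXprob : IsProbabilityMeasure μX)
    (hXsupp : μX (Icc 0 1) = 1)
    (fX : ℝ → ℝ) (hfXmeas : Measurable fX)
    (hXdens : μX = volume.withDensity fun x => ENNReal.ofReal (fX x))
    (cX : ℝ) (hcX : 0 < cX)
    (hfXlb : ∀ x ∈ Function.support fX, cX ≤ fX x) :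
    ∃ K > 0, ∀ n ≥ 1,
      ∃ mhat : ((Fin n → ℝ) × (Fin n → ℝ)) → ℝ → ℝ,
        (∀ d, mhat d ∈ LCRR) ∧
        Measurable (fun p : ((Fin n → ℝ) × (Fin n → ℝ)) × ℝ => mhat p.1 p.2) ∧
        ∀ m ∈ MM μX M a,
          empRisk (shuffledLaw μX μδ (σ n) m n) mhat m ≤
            ENNReal.ofReal (K * σ n) := by
  have := hδprob
  have := hXprob
  have hna : ∀ x, μX {x} = 0 := by
    intro x
    rw [hXdens]
    exact withDensity_absolutelyContinuous _ _ (by simp)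
  set E : ℝ≥0∞ := ∫⁻ x, ENNReal.ofReal |x| ∂μδ with hE
  have hEfin : E ≠ ⊤ := by
    refine ne_top_of_le_ne_top (b := 1 + ∫⁻ x, ENNReal.ofReal (x ^ 2) ∂μδ)
      (ENNReal.add_ne_top.2 ⟨by simp, hvarfin.ne⟩) ?_
    calc E ≤ ∫⁻ x, (1 + ENNReal.ofReal (x ^ 2)) ∂μδ := by
          refine lintegral_mono fun x => ?_
          rw [← ENNReal.ofReal_one, ← ENNReal.ofReal_add zero_le_one (sq_nonneg _)]
          refine ENNReal.ofReal_le_ofReal ?_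
          rw [← sq_abs]
          nlinarith [sq_nonneg (|x| - 1), abs_nonneg x]
      _ = _ := by
          rw [lintegral_add_left measurable_const]
          simp
  refine ⟨E.toReal + 1, by positivity, fun n hn => ?_⟩
  have hn0 : 0 < n := hn
  refine ⟨est hn0, est_LCRR hn0, measurable_est hn0, fun m hm => ?_⟩
  unfold empRisk shuffledLaw
  refine (lintegral_map_le _ _).trans ?_
  have hσ := (hσpos n).le
  calc _ ≤ ∫⁻ ω, (n : ℝ≥0∞)⁻¹ * ∑ i : Fin n, ENNReal.ofReal (σ n) * ENNReal.ofReal |(ω i).2|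
        ∂(Measure.pi fun _ : Fin n => μX.prod μδ) := by
        refine lintegral_mono_ae ?_
        filter_upwards [ae_distinct (n := n) μX μδ hna, ae_mem (n := n) μX μδ hXsupp]
          with ω h1 h2
        refine mul_le_mul_right ?_ _
        refine (det_bound hn0 (fun i => (ω i).1) (fun i => m (ω i).1 + σ n * (ω i).2) m
          hm.1.1 h2 h1).trans (le_of_eq ?_)
        refine Finset.sum_congr rfl fun i _ => ?_
        rw [add_sub_cancel_left, abs_mul, abs_of_nonneg hσ, ENNReal.ofReal_mul hσ]
    _ = ENNReal.ofReal (σ n) * E := by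
        rw [lintegral_const_mul _ (by fun_prop), lintegral_finsetSum _ (fun i _ => by fun_prop)]
        have : ∀ i : Fin n, ∫⁻ ω, ENNReal.ofReal (σ n) * ENNReal.ofReal |(ω i).2|
            ∂(Measure.pi fun _ : Fin n => μX.prod μδ) = ENNReal.ofReal (σ n) * E := by
          intro i
          rw [lintegral_const_mul _ (by fun_prop)]
          congr 1
          exact (measurePreserving_snd.comp
            (measurePreserving_eval (fun _ : Fin n => μX.prod μδ) i)).lintegral_comp
            (f := fun x : ℝ => ENNReal.ofReal |x|) (by fun_prop)
        simp only [this, Finset.sum_const, Finset.card_univ, Fintype.card_fin, nsmul_eq_mul]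
        rw [← mul_assoc, ENNReal.inv_mul_cancel (by simpa using hn0.ne') (by simp), one_mul]
    _ ≤ ENNReal.ofReal ((E.toReal + 1) * σ n) := by
        rw [mul_comm, ENNReal.ofReal_mul (by positivity)]
        refine mul_le_mul_left ?_ _
        conv_lhs => rw [← ENNReal.ofReal_toReal hEfin]
        exact ENNReal.ofReal_le_ofReal (by linarith)
end
end

section
/- Let (σ_n) be a bounded sequence of positive real numbers, a, M > 0. In the shuffled regression model, suppose the error δ is centered with E δ² < ∞ and the covariate distribution μ_X on [0,1] has a density bounded below by a known constant c_X > 0 on its support. Then there exists K > 0, not depending on n, such that for every n ≥ 2 the population shuffled minimax risk satisfies R_S(M,a,n,μ_X) ≤ K·(σ_n + n^{−(a+1)/(a+2)}·log n). -/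
open MeasureTheory ProbabilityTheory Filter Set
open scoped ENNReal NNReal Classical

noncomputable section

namespace Shuf

/-- sorted values -/
def srt {N : ℕ} (y : Fin (N+1) → ℝ) (j : Fin (N+1)) : ℝ := y (Tuple.sort y j)

/-- number of samples strictly below `x` -/
def cnt {N : ℕ} (X : Fin (N+1) → ℝ) (x : ℝ) : Fin (N+2) :=
  ⟨(Finset.univ.filter fun i => X i < x).card,
    Nat.lt_succ_of_le ((Finset.card_le_univ _).trans (by simp))⟩

/-- truncated index -/
def idx {N : ℕ} (j : Fin (N+2)) : Fin (N+1) := ⟨min j.1 N, by omega⟩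

/-- the estimator -/
def est {N : ℕ} (d : (Fin (N+1) → ℝ) × (Fin (N+1) → ℝ)) (x : ℝ) : ℝ :=
  srt d.1 (idx (cnt d.2 x))

lemma idx_mono {N : ℕ} : Monotone (idx (N := N)) := by
  intro a b h
  have : a.1 ≤ b.1 := h
  show min a.1 N ≤ min b.1 N
  omega

lemma cnt_mono {N : ℕ} (X : Fin (N+1) → ℝ) : Monotone (cnt X) := by
  intro a b h
  simp only [cnt, Fin.mk_le_mk]
  apply Finset.card_le_card
  intro i hi
  simp only [Finset.mem_filter, Finset.mem_univ, true_and] at hi ⊢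
  linarith

lemma srt_mono {N : ℕ} (y : Fin (N+1) → ℝ) : Monotone (srt y) := Tuple.monotone_sort y

lemma cnt_perm {N : ℕ} (X : Fin (N+1) → ℝ) (p : Equiv.Perm (Fin (N+1))) (x : ℝ) :
    cnt (fun j => X (p j)) x = cnt X x := by
  apply Fin.ext
  simp only [cnt]
  refine Finset.card_bij (fun i _ => p i) ?_ ?_ ?_
  · intro i hi; simpa using hi
  · intro i _ j _ h; exact p.injective h
  · intro b hb
    exact ⟨p.symm b, by simpa using hb, by simp⟩

lemma est_lcrr {N : ℕ} (d : (Fin (N+1) → ℝ) × (Fin (N+1) → ℝ)) : est d ∈ LCRR := by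
  refine ⟨?_, ?_, ?_⟩
  · intro x _ y _ h
    exact srt_mono _ (idx_mono (cnt_mono _ h))
  · intro x _
    have h : ∀ᶠ y in nhdsWithin x (Iio x), ∀ i, (d.2 i < y ↔ d.2 i < x) := by
      rw [Filter.eventually_all]
      intro i
      by_cases hi : d.2 i < x
      · filter_upwards [mem_nhdsWithin_of_mem_nhds (Ioi_mem_nhds hi)] with y hy
        exact ⟨fun _ => hi, fun _ => hy⟩
      · filter_upwards [self_mem_nhdsWithin] with y hy
        exact ⟨fun h => absurd (h.trans hy) hi, fun h => absurd h hi⟩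
    refine tendsto_const_nhds.congr' ?_
    filter_upwards [h] with y hy
    have : cnt d.2 y = cnt d.2 x := by
      apply Fin.ext
      simp only [cnt, hy]
    simp only [est, this]
  · intro x _
    have h : ∀ᶠ y in nhdsWithin x (Ioi x), ∀ i, (d.2 i < y ↔ d.2 i ≤ x) := by
      rw [Filter.eventually_all]
      intro i
      by_cases hi : d.2 i ≤ x
      · filter_upwards [self_mem_nhdsWithin] with y hy
        exact ⟨fun _ => hi, fun h => lt_of_le_of_lt h hy⟩
      · filter_upwards [mem_nhdsWithin_of_mem_nhds (Iio_mem_nhds (not_le.1 hi))] with y hy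
        exact ⟨fun h => absurd h (not_lt.2 (le_of_lt hy)), fun h => absurd h hi⟩
    obtain ⟨y0, hy0⟩ := h.exists
    refine ⟨est d y0, tendsto_const_nhds.congr' ?_⟩
    filter_upwards [h] with y hy
    have : cnt d.2 y0 = cnt d.2 y := by
      apply Fin.ext
      simp only [cnt, hy, hy0]
    simp only [est, this]

lemma srt_meas {N : ℕ} (j : Fin (N+1)) : Measurable (fun y : Fin (N+1) → ℝ => srt y j) := by
  have h : ∀ p : Equiv.Perm (Fin (N+1)),
      MeasurableSet {y : Fin (N+1) → ℝ | Tuple.sort y = p} := by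
    intro p
    have : {y : Fin (N+1) → ℝ | Tuple.sort y = p} =
      {y | (∀ i j, i ≤ j → y (p i) ≤ y (p j)) ∧
        ∀ i j, i < j → y (p i) = y (p j) → p i < p j} := by
      ext y
      simp only [mem_ofPred_eq]
      rw [eq_comm, Tuple.eq_sort_iff]
      rfl
    rw [this]
    measurability
  have e : (fun y : Fin (N+1) → ℝ => srt y j) = fun y => ∑ p : Equiv.Perm (Fin (N+1)),
      Set.indicator {y : Fin (N+1) → ℝ | Tuple.sort y = p} (fun y => y (p j)) y := by
    ext y
    rw [Finset.sum_eq_single (Tuple.sort y)]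
    · simp [srt]
    · intro p _ hp
      simp [Set.indicator, hp.symm]
    · simp
  rw [e]
  refine Finset.measurable_sum _ fun p _ => ?_
  exact (measurable_pi_apply _).indicator (h p)

lemma cnt_meas {N : ℕ} : Measurable (fun q : (Fin (N+1) → ℝ) × ℝ => cnt q.1 q.2) := by
  have : Measurable (fun q : (Fin (N+1) → ℝ) × ℝ =>
      (Finset.univ.filter fun i => q.1 i < q.2).card) := by
    simp only [Finset.card_filter]
    refine Finset.measurable_sum _ fun i _ => ?_
    refine Measurable.ite ?_ measurable_const measurable_const
    exact measurableSet_lt (by fun_prop) (by fun_prop)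
  refine measurable_to_countable' fun j => ?_
  have e : (fun q : (Fin (N+1) → ℝ) × ℝ => cnt q.1 q.2) ⁻¹' {j} =
      (fun q : (Fin (N+1) → ℝ) × ℝ =>
      (Finset.univ.filter fun i => q.1 i < q.2).card) ⁻¹' {j.1} := by
    ext q
    simp [cnt, Fin.ext_iff]
  rw [e]
  exact this (measurableSet_singleton _)

lemma est_meas {N : ℕ} : Measurable
    (fun p : ((Fin (N+1) → ℝ) × (Fin (N+1) → ℝ)) × ℝ => est p.1 p.2) := by
  have e : (fun p : ((Fin (N+1) → ℝ) × (Fin (N+1) → ℝ)) × ℝ => est p.1 p.2) = fun p =>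
      ∑ j : Fin (N+2), Set.indicator
        {p : ((Fin (N+1) → ℝ) × (Fin (N+1) → ℝ)) × ℝ | cnt p.1.2 p.2 = j}
        (fun p => srt p.1.1 (idx j)) p := by
    ext p
    rw [Finset.sum_eq_single (cnt p.1.2 p.2)]
    · simp [est]
    · intro j _ hj
      simp [Set.indicator, hj.symm]
    · simp
  rw [e]
  refine Finset.measurable_sum _ fun j _ => ?_
  refine ((srt_meas _).comp (by fun_prop)).indicator ?_
  exact (cnt_meas.comp (f := fun p : ((Fin (N+1) → ℝ) × (Fin (N+1) → ℝ)) × ℝ => (p.1.2, p.2))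
    (by fun_prop)) (measurableSet_singleton j)

/-- l2 sorting inequality -/
lemma sort_l2 {N : ℕ} (m : ℝ → ℝ) (hm : Monotone m) (X Y : Fin (N+1) → ℝ) :
    ∑ j, (srt Y j - m (srt X j)) ^ 2 ≤ ∑ i, (Y i - m (X i)) ^ 2 := by
  have hp : Monotone (fun j => m (srt X j)) := hm.comp (srt_mono X)
  have hmv : Monovary (fun j => m (srt X j)) (srt Y) := hp.monovary (srt_mono Y)
  have h := hmv.sum_mul_comp_perm_le_sum_mul (σ := (Tuple.sort X).trans (Tuple.sort Y).symm)
  have h2 : ∀ j, srt Y (((Tuple.sort X).trans (Tuple.sort Y).symm) j) = Y (Tuple.sort X j) := by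
    intro j; simp [srt]
  simp only [h2] at h
  have e1 : ∑ i, (Y i - m (X i)) ^ 2 = ∑ j, (Y (Tuple.sort X j) - m (srt X j)) ^ 2 :=
    (Equiv.sum_comp (Tuple.sort X) (fun i => (Y i - m (X i)) ^ 2)).symm
  have e2 : ∑ j, (srt Y j) ^ 2 = ∑ j, (Y (Tuple.sort X j)) ^ 2 := by
    rw [Equiv.sum_comp (Tuple.sort X) (fun i => (Y i) ^ 2)]
    exact Equiv.sum_comp (Tuple.sort Y) (fun i => (Y i) ^ 2)
  rw [e1]
  simp only [sub_sq, Finset.sum_add_distrib, Finset.sum_sub_distrib, e2]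
  have e3 : ∀ f : Fin (N+1) → ℝ, ∑ j, 2 * f j * m (srt X j) = 2 * ∑ j, m (srt X j) * f j := by
    intro f
    rw [Finset.mul_sum]
    exact Finset.sum_congr rfl fun j _ => by ring
  rw [e3, e3 (fun j => Y (Tuple.sort X j))]
  linarith

lemma srt_lt_iff {N : ℕ} (X : Fin (N+1) → ℝ) (x : ℝ) (j : Fin (N+1)) :
    srt X j < x ↔ j.1 < (cnt X x).1 := by
  rw [← cnt_perm X (Tuple.sort X) x]
  symm
  unfold cnt
  refine Fin.lt_card_filter_univ_iff_apply_of_imp (fun i => srt X i < x) ?_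
  intro i k hik h
  exact lt_of_le_of_lt (srt_mono X hik) h

lemma exists_srt {N : ℕ} (X : Fin (N+1) → ℝ) (i : Fin (N+1)) : ∃ j, srt X j = X i :=
  ⟨(Tuple.sort X).symm i, by simp [srt]⟩

/-- any sample above x is above the selected sample -/
lemma sel_le {N : ℕ} (X : Fin (N+1) → ℝ) (x : ℝ) (i : Fin (N+1)) (h : x ≤ X i) :
    srt X (idx (cnt X x)) ≤ X i := by
  obtain ⟨j, hj⟩ := exists_srt X i
  rw [← hj] at h ⊢
  apply srt_mono
  have := (srt_lt_iff X x j).not.1 (not_lt.2 h)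
  show min _ N ≤ j.1
  omega

lemma sel_lt {N : ℕ} (X : Fin (N+1) → ℝ) (x : ℝ) (i : Fin (N+1))
    (h : srt X (idx (cnt X x)) < x) : X i ≤ srt X (idx (cnt X x)) := by
  obtain ⟨j, hj⟩ := exists_srt X i
  rw [← hj]
  apply srt_mono
  have := (srt_lt_iff X x _).1 h
  have h3 : (idx (cnt X x)).1 = min (cnt X x).1 N := rfl
  show j.1 ≤ (idx (cnt X x)).1
  omega

lemma cnt_eq {N : ℕ} (X : Fin (N+1) → ℝ) (x x' : ℝ) (h : cnt X x = cnt X x')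
    (i : Fin (N+1)) : ¬ (X i < x' ∧ x ≤ X i) := by
  intro hi
  obtain ⟨j, hj⟩ := exists_srt X i
  rw [← hj] at hi
  have := (srt_lt_iff X x' j).1 hi.1
  have := (srt_lt_iff X x j).not.1 (not_lt.2 hi.2)
  rw [h] at this
  contradiction

lemma core_int (n : ℕ) (μ : Measure ℝ) [IsProbabilityMeasure μ] (A : Set ℝ)
    (hA : MeasurableSet A) :
    ((n + 1 : ℕ) : ℝ≥0∞) * ∫⁻ x in A, μ (A ∩ Ici x)ᶜ ^ n ∂μ ≤ 1 := by
  let E : Set (ℝ × (Fin n → ℝ)) := {p | p.1 ∈ A ∧ ∀ j, ¬ (p.2 j ∈ A ∧ p.1 ≤ p.2 j)}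
  have hE : MeasurableSet E := by
    have h1 : MeasurableSet {p : ℝ × (Fin n → ℝ) | p.1 ∈ A} := measurable_fst hA
    have h2 : ∀ j, MeasurableSet {p : ℝ × (Fin n → ℝ) | ¬ (p.2 j ∈ A ∧ p.1 ≤ p.2 j)} := by
      intro j
      have a1 : MeasurableSet {p : ℝ × (Fin n → ℝ) | p.2 j ∈ A} :=
        ((measurable_pi_apply j).comp measurable_snd) hA
      have a2 : MeasurableSet {p : ℝ × (Fin n → ℝ) | p.1 ≤ p.2 j} :=
        measurableSet_le measurable_fst ((measurable_pi_apply j).comp measurable_snd)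
      exact (a1.inter a2).compl
    have : E = {p : ℝ × (Fin n → ℝ) | p.1 ∈ A} ∩
        ⋂ j, {p : ℝ × (Fin n → ℝ) | ¬ (p.2 j ∈ A ∧ p.1 ≤ p.2 j)} := by
      ext p; simp [E]
    rw [this]
    exact h1.inter (MeasurableSet.iInter h2)
  have hval : (μ.prod (Measure.pi fun _ : Fin n => μ)) E = ∫⁻ x in A, μ (A ∩ Ici x)ᶜ ^ n ∂μ := by
    rw [Measure.prod_apply hE, ← lintegral_indicator hA]
    congr 1
    ext x
    by_cases hx : x ∈ A
    · have : Prod.mk x ⁻¹' E = Set.univ.pi (fun _ : Fin n => (A ∩ Ici x)ᶜ) := by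
        ext r
        simp [E, hx, Set.mem_pi]
      rw [this, Measure.pi_pi]
      simp [hx]
    · have : Prod.mk x ⁻¹' E = ∅ := by
        ext r
        simp [E, hx]
      simp [this, hx]
  let e := fun i : Fin (n+1) => MeasurableEquiv.piFinSuccAbove (fun _ : Fin (n+1) => ℝ) i
  have hmp : ∀ i, (Measure.pi fun _ : Fin (n+1) => μ) (e i ⁻¹' E) =
      ∫⁻ x in A, μ (A ∩ Ici x)ᶜ ^ n ∂μ := by
    intro i
    rw [← hval]
    exact (measurePreserving_piFinSuccAbove (fun _ : Fin (n+1) => μ) i).measure_preimage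
      hE.nullMeasurableSet
  have hdisj : Pairwise (Function.onFun Disjoint fun i => e i ⁻¹' E) := by
    intro i k hik
    rw [Function.onFun, Set.disjoint_left]
    intro w hi hk
    have hi1 : w i ∈ A := hi.1
    have hk1 : w k ∈ A := hk.1
    obtain ⟨j, hj⟩ := Fin.exists_succAbove_eq hik.symm
    obtain ⟨l, hl⟩ := Fin.exists_succAbove_eq hik
    have h1 : ¬ (w (i.succAbove j) ∈ A ∧ w i ≤ w (i.succAbove j)) := hi.2 j
    have h2 : ¬ (w (k.succAbove l) ∈ A ∧ w k ≤ w (k.succAbove l)) := hk.2 l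
    rw [hj] at h1
    rw [hl] at h2
    rcases le_total (w i) (w k) with h | h
    · exact h1 ⟨hk1, h⟩
    · exact h2 ⟨hi1, h⟩
  have hU := measure_iUnion (μ := Measure.pi fun _ : Fin (n+1) => μ) hdisj
    (fun i => (e i).measurable hE)
  calc _ = ∑ i : Fin (n+1), (Measure.pi fun _ : Fin (n+1) => μ) (e i ⁻¹' E) := by
        simp [hmp]
    _ = _ := by rw [hU, tsum_fintype]
    _ ≤ 1 := prob_le_one

lemma core_int' (n : ℕ) (μ : Measure ℝ) [IsProbabilityMeasure μ] (A : Set ℝ)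
    (hA : MeasurableSet A) :
    ∫⁻ x in A, μ (A ∩ Ici x)ᶜ ^ n ∂μ ≤ ((n + 1 : ℕ) : ℝ≥0∞)⁻¹ := by
  rw [ENNReal.le_inv_iff_mul_le, mul_comm]
  exact core_int n μ A hA

/-- the joint law of the sample -/
abbrev PP (μX μδ : Measure ℝ) (N : ℕ) : Measure (Fin (N+1) → ℝ × ℝ) :=
  Measure.pi fun _ : Fin (N+1) => μX.prod μδ

lemma PP_rect (μX μδ : Measure ℝ) [IsProbabilityMeasure μX] [IsProbabilityMeasure μδ] (N : ℕ)
    (S : Fin (N+1) → Set ℝ) :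
    PP μX μδ N {ω | ∀ i, (ω i).1 ∈ S i} = ∏ i, μX (S i) := by
  have : {ω : Fin (N+1) → ℝ × ℝ | ∀ i, (ω i).1 ∈ S i} =
      Set.univ.pi (fun i => S i ×ˢ (Set.univ : Set ℝ)) := by
    ext ω; simp [Set.mem_pi]
  rw [this, PP, Measure.pi_pi]
  simp [Measure.prod_prod]

lemma PP_none (μX μδ : Measure ℝ) [IsProbabilityMeasure μX] [IsProbabilityMeasure μδ] (N : ℕ)
    (S : Set ℝ) :
    PP μX μδ N {ω | ∀ i, (ω i).1 ∈ S} = μX S ^ (N+1) := by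
  rw [PP_rect μX μδ N (fun _ => S)]; simp

/-- one sample in B and none in C, with B, C disjoint -/
lemma PP_some (μX μδ : Measure ℝ) [IsProbabilityMeasure μX] [IsProbabilityMeasure μδ] (N : ℕ)
    (B S : Set ℝ) :
    PP μX μδ N {ω | (∃ i, (ω i).1 ∈ B) ∧ ∀ i, (ω i).1 ∈ S} ≤
      ((N + 1 : ℕ) : ℝ≥0∞) * (μX B * μX S ^ N) := by
  have hsub : {ω : Fin (N+1) → ℝ × ℝ | (∃ i, (ω i).1 ∈ B) ∧ ∀ i, (ω i).1 ∈ S} ⊆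
      ⋃ i : Fin (N+1), {ω | ∀ k, (ω k).1 ∈ (if k = i then B else S)} := by
    rintro ω ⟨⟨i, hi⟩, h⟩
    refine mem_iUnion.2 ⟨i, fun k => ?_⟩
    by_cases hk : k = i
    · subst hk; simpa using hi
    · simpa [hk] using h k
  refine (measure_mono hsub).trans ((measure_iUnion_le _).trans ?_)
  rw [tsum_fintype]
  have : ∀ i : Fin (N+1), PP μX μδ N {ω | ∀ k, (ω k).1 ∈ (if k = i then B else S)} =
      μX B * μX S ^ N := by
    intro i
    rw [PP_rect μX μδ N (fun k => if k = i then B else S),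
      Fin.prod_univ_succAbove _ i]
    simp [Fin.succAbove_ne]
  simp only [this]
  simp

lemma ind_le {α β : Type*} (S : Set α) (R : Set β) (x : α) (y : β) (h : x ∈ S → y ∈ R) :
    S.indicator (1 : α → ℝ≥0∞) x ≤ R.indicator (1 : β → ℝ≥0∞) y := by
  by_cases hx : x ∈ S
  · rw [Set.indicator_of_mem hx, Set.indicator_of_mem (h hx)]
    rfl
  · rw [Set.indicator_of_notMem hx]
    exact zero_le

lemma triple_swap {Ω : Type*} [MeasurableSpace Ω] (P : Measure Ω) (μ ν : Measure ℝ)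
    [SFinite P] [SFinite μ] [SFinite ν] (f : (Ω × ℝ) × ℝ → ℝ≥0∞) (hf : Measurable f) :
    ∫⁻ ω, ∫⁻ x, ∫⁻ t, f ((ω, x), t) ∂ν ∂μ ∂P = ∫⁻ t, ∫⁻ x, ∫⁻ ω, f ((ω, x), t) ∂P ∂μ ∂ν := by
  have h1 : Measurable fun z : Ω × ℝ => ∫⁻ t, f (z, t) ∂ν := hf.lintegral_prod_right'
  rw [← lintegral_prod (μ := P) (ν := μ) (fun z : Ω × ℝ => ∫⁻ t, f (z, t) ∂ν) h1.aemeasurable]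
  rw [← lintegral_prod (μ := P.prod μ) (ν := ν) f hf.aemeasurable]
  rw [lintegral_prod_symm _ hf.aemeasurable]
  refine lintegral_congr fun t => ?_
  have h2 : Measurable fun z : Ω × ℝ => f (z, t) := hf.comp (by fun_prop)
  rw [lintegral_prod_symm _ h2.aemeasurable]

/-- the event sets for thresholds -/
def EV (m : ℝ → ℝ) (N : ℕ) : Set (((Fin (N+1) → ℝ × ℝ) × ℝ) × ℝ) :=
  {q | m q.1.2 < q.2 ∧ (∃ i, q.2 ≤ m (q.1.1 i).1) ∧
      ∀ i, ¬ (m (q.1.1 i).1 < q.2 ∧ q.1.2 ≤ (q.1.1 i).1)} ∪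
  {q | q.2 ≤ m q.1.2 ∧ ∀ i, m (q.1.1 i).1 < q.2}

lemma EV_meas (m : ℝ → ℝ) (hm : Measurable m) (N : ℕ) : MeasurableSet (EV m N) := by
  have hx : Measurable fun q : ((Fin (N+1) → ℝ × ℝ) × ℝ) × ℝ => m q.1.2 :=
    hm.comp (by fun_prop)
  have hX : ∀ i, Measurable fun q : ((Fin (N+1) → ℝ × ℝ) × ℝ) × ℝ => m (q.1.1 i).1 :=
    fun i => hm.comp (by fun_prop)
  have ht : Measurable fun q : ((Fin (N+1) → ℝ × ℝ) × ℝ) × ℝ => q.2 := by fun_prop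
  refine MeasurableSet.union ?_ ?_
  · refine (measurableSet_lt hx ht).inter (MeasurableSet.inter ?_ ?_)
    · exact (MeasurableSet.iUnion fun i => measurableSet_le ht (hX i)).congr (by ext; simp; rfl)
    · refine (MeasurableSet.iInter fun i => ((measurableSet_lt (hX i) ht).inter
        (measurableSet_le (f := fun q : ((Fin (N+1) → ℝ × ℝ) × ℝ) × ℝ => q.1.2)
          (g := fun q => (q.1.1 i).1) (by fun_prop) (by fun_prop))).compl).congr ?_
      ext; simp; rfl
  · refine (measurableSet_le ht hx).inter ?_
    exact (MeasurableSet.iInter fun i => measurableSet_lt (hX i) ht).congr (by ext; simp; rfl)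

lemma diff_le (m : ℝ → ℝ) (hm : Monotone m) (N : ℕ) (ω : Fin (N+1) → ℝ × ℝ) (x : ℝ) :
    ENNReal.ofReal |m (srt (fun i => (ω i).1) (idx (cnt (fun i => (ω i).1) x))) - m x| ≤
      ∫⁻ t, (EV m N).indicator 1 ((ω, x), t) := by
  set X : Fin (N+1) → ℝ := fun i => (ω i).1 with hX
  set z := srt X (idx (cnt X x)) with hz
  have hzi : ∃ i, X i = z := ⟨_, rfl⟩
  have hS : MeasurableSet {t : ℝ | m x < t ∧ t ≤ m z ∨ m z < t ∧ t ≤ m x} :=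
    (measurableSet_Ioc (a := m x) (b := m z)).union (measurableSet_Ioc (a := m z) (b := m x))
  have hsub : {t : ℝ | m x < t ∧ t ≤ m z ∨ m z < t ∧ t ≤ m x} ⊆
      {t | ((ω, x), t) ∈ EV m N} := by
    rintro t (⟨h1, h2⟩ | ⟨h1, h2⟩)
    · left
      refine ⟨h1, ?_, ?_⟩
      · obtain ⟨i, hi⟩ := hzi
        exact ⟨i, by rw [← hi] at h2; exact h2⟩
      · rintro i ⟨h3, h4⟩
        have h5 : z ≤ X i := sel_le X x i h4
        have := hm h5
        have h3' : m (X i) < t := h3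
        linarith
    · right
      refine ⟨h2, fun i => ?_⟩
      have hlt : z < x := by
        by_contra h
        have := hm (not_lt.1 h)
        linarith
      have := hm (sel_lt X x i hlt)
      show m (X i) < t
      exact lt_of_le_of_lt this h1
  calc ENNReal.ofReal |m z - m x|
      ≤ volume {t : ℝ | m x < t ∧ t ≤ m z ∨ m z < t ∧ t ≤ m x} := by
        rcases le_total (m x) (m z) with h | h
        · rw [abs_of_nonneg (by linarith), ← Real.volume_Ioc]
          exact measure_mono fun t ht => Or.inl ht
        · rw [abs_of_nonpos (by linarith), neg_sub, ← Real.volume_Ioc]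
          exact measure_mono fun t ht => Or.inr ht
    _ = ∫⁻ t, {t : ℝ | m x < t ∧ t ≤ m z ∨ m z < t ∧ t ≤ m x}.indicator 1 t := by
        rw [lintegral_indicator_one hS]
    _ ≤ _ := by
        refine lintegral_mono fun t => ?_
        by_cases ht : t ∈ {t : ℝ | m x < t ∧ t ≤ m z ∨ m z < t ∧ t ≤ m x}
        · have h2 : ((ω, x), t) ∈ EV m N := hsub ht
          rw [Set.indicator_of_mem ht, Set.indicator_of_mem h2]
          rfl
        · rw [Set.indicator_of_notMem ht]
          exact zero_le

lemma J_bound (μX μδ : Measure ℝ) [IsProbabilityMeasure μX] [IsProbabilityMeasure μδ]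
    (m : ℝ → ℝ) (hm : Measurable m) (N : ℕ) (t : ℝ) :
    ∫⁻ x, ∫⁻ ω, (EV m N).indicator 1 ((ω, x), t) ∂(PP μX μδ N) ∂μX ≤
      2 * min ((N + 1 : ℕ) : ℝ≥0∞)⁻¹ (min (μX {x | m x < t}) (μX {x | t ≤ m x})) := by
  set A : Set ℝ := {x | m x < t} with hAd
  set B : Set ℝ := {x | t ≤ m x} with hBd
  have hA : MeasurableSet A := measurableSet_lt hm measurable_const
  have hB : MeasurableSet B := measurableSet_le measurable_const hm
  have hAB : A = Bᶜ := by ext x; simp [hAd, hBd]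
  let p1 : ℝ → ℝ≥0∞ := fun x => PP μX μδ N
    {ω | (∃ i, (ω i).1 ∈ B) ∧ ∀ i, (ω i).1 ∈ (A ∩ Ici x)ᶜ}
  let p2 : ℝ≥0∞ := PP μX μδ N {ω | ∀ i, (ω i).1 ∈ A}
  have hp2 : p2 = μX A ^ (N+1) := PP_none μX μδ N A
  have hpt : ∀ x, ∫⁻ ω, (EV m N).indicator 1 ((ω, x), t) ∂(PP μX μδ N) =
      A.indicator p1 x + B.indicator (fun _ => p2) x := by
    intro x
    have hms : MeasurableSet {ω : Fin (N+1) → ℝ × ℝ | ((ω, x), t) ∈ EV m N} :=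
      (by fun_prop : Measurable fun ω : Fin (N+1) → ℝ × ℝ => ((ω, x), t)) (EV_meas m hm N)
    have e1 : ∫⁻ ω, (EV m N).indicator 1 ((ω, x), t) ∂(PP μX μδ N) =
        PP μX μδ N {ω | ((ω, x), t) ∈ EV m N} := by
      rw [← lintegral_indicator_one hms]
      rfl
    rw [e1]
    by_cases hx : x ∈ A
    · have hxB : x ∉ B := by rw [hAB] at hx; exact hx
      rw [Set.indicator_of_mem hx, Set.indicator_of_notMem hxB, add_zero]
      congr 1
      ext ω
      have h1 : m x < t := hx
      simp [EV, h1, not_le.2 h1, A, B]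
    · have hxB : x ∈ B := by rw [hAB] at hx; simpa using hx
      rw [Set.indicator_of_notMem hx, Set.indicator_of_mem hxB, zero_add]
      congr 1
      ext ω
      have h1 : t ≤ m x := hxB
      simp [EV, h1, not_lt.2 h1, A]
  simp only [hpt]
  rw [lintegral_add_right _ (measurable_const.indicator hB), lintegral_indicator hA,
    lintegral_indicator hB, two_mul]
  refine add_le_add ?_ ?_
  · refine le_min ?_ (le_min ?_ ?_)
    · calc ∫⁻ x in A, p1 x ∂μX ≤ ∫⁻ x in A, μX (A ∩ Ici x)ᶜ ^ (N+1) ∂μX := by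
            refine lintegral_mono fun x => ?_
            rw [← PP_none μX μδ N]
            exact measure_mono fun ω h => h.2
        _ ≤ ((N + 1 + 1 : ℕ) : ℝ≥0∞)⁻¹ := core_int' (N+1) μX A hA
        _ ≤ _ := by
            apply ENNReal.inv_le_inv.2
            exact_mod_cast Nat.le_succ _
    · calc ∫⁻ x in A, p1 x ∂μX ≤ ∫⁻ x in A, 1 ∂μX := lintegral_mono fun x => prob_le_one
        _ = μX A := by simp
    · calc ∫⁻ x in A, p1 x ∂μX
          ≤ ∫⁻ x in A, ((N + 1 : ℕ) : ℝ≥0∞) * μX B * μX (A ∩ Ici x)ᶜ ^ N ∂μX := by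
            refine lintegral_mono fun x => ?_
            rw [mul_assoc]
            exact PP_some μX μδ N B _
        _ = μX B * (((N + 1 : ℕ) : ℝ≥0∞) * ∫⁻ x in A, μX (A ∩ Ici x)ᶜ ^ N ∂μX) := by
            rw [lintegral_const_mul' _ _ (ENNReal.mul_ne_top (by simp) (measure_ne_top _ _))]
            ring
        _ ≤ μX B * 1 := by gcongr; exact core_int N μX A hA
        _ = _ := mul_one _
  · refine le_min ?_ (le_min ?_ ?_)
    · calc ∫⁻ x in B, p2 ∂μX ≤ ∫⁻ x in B, μX (B ∩ Ici x)ᶜ ^ (N+1) ∂μX := by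
            refine lintegral_mono fun x => ?_
            rw [hp2]
            gcongr
            rw [hAB]
            exact compl_subset_compl.2 inter_subset_left
        _ ≤ ((N + 1 + 1 : ℕ) : ℝ≥0∞)⁻¹ := core_int' (N+1) μX B hB
        _ ≤ _ := by
            apply ENNReal.inv_le_inv.2
            exact_mod_cast Nat.le_succ _
    · rw [setLIntegral_const, hp2]
      calc μX A ^ (N+1) * μX B ≤ μX A ^ (N+1) * 1 := by gcongr; exact prob_le_one
        _ = μX A * μX A ^ N := by rw [mul_one, pow_succ, mul_comm]
        _ ≤ μX A * 1 := by gcongr; exact pow_le_one₀ zero_le prob_le_one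
        _ = _ := mul_one _
    · rw [setLIntegral_const]
      calc p2 * μX B ≤ 1 * μX B := by gcongr; exact prob_le_one
        _ = _ := one_mul _

lemma tail_pt (a T y : ℝ) (ha : 0 < a) (hT : 0 < T) :
    ENNReal.ofReal (y - T) + ENNReal.ofReal (-T - y) ≤
      ENNReal.ofReal (T ^ (-(a+1))) * ENNReal.ofReal (|y| ^ (a+2)) := by
  have key : T ≤ |y| → |y| - T ≤ T ^ (-(a+1)) * |y| ^ (a+2) := by
    intro h
    have hy : 0 < |y| := hT.trans_le h
    have e : |y| ^ (a+2) = |y| * |y| ^ (a+1) := by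
      rw [show a + 2 = 1 + (a+1) by ring, Real.rpow_add hy, Real.rpow_one]
    have h1 : T ^ (a+1) ≤ |y| ^ (a+1) := Real.rpow_le_rpow hT.le h (by linarith)
    have h2 : 0 < T ^ (a+1) := Real.rpow_pos_of_pos hT _
    rw [Real.rpow_neg hT.le, e]
    have h3 : 1 ≤ (T ^ (a+1))⁻¹ * |y| ^ (a+1) := by
      rw [inv_mul_eq_div, le_div_iff₀ h2]; linarith
    calc |y| - T ≤ |y| * 1 := by linarith
      _ ≤ |y| * ((T ^ (a+1))⁻¹ * |y| ^ (a+1)) := by gcongr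
      _ = _ := by ring
  rw [← ENNReal.ofReal_mul (by positivity)]
  rcases le_total 0 y with h | h
  · rw [ENNReal.ofReal_of_nonpos (p := -T - y) (by linarith), add_zero]
    rw [abs_of_nonneg h] at key ⊢
    by_cases hy : T ≤ y
    · exact ENNReal.ofReal_le_ofReal (key hy)
    · rw [ENNReal.ofReal_of_nonpos (by linarith)]; exact zero_le
  · rw [ENNReal.ofReal_of_nonpos (p := y - T) (by linarith), zero_add]
    rw [abs_of_nonpos h] at key ⊢
    by_cases hy : T ≤ -y
    · have := key hy
      exact ENNReal.ofReal_le_ofReal (by linarith)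
    · rw [ENNReal.ofReal_of_nonpos (by linarith)]; exact zero_le

lemma term2 (μX μδ : Measure ℝ) [IsProbabilityMeasure μX] [IsProbabilityMeasure μδ]
    (m : ℝ → ℝ) (hm : Monotone m) (N : ℕ) (a M T : ℝ) (ha : 0 < a) (hT : 0 < T)
    (hM : ∫⁻ x, ENNReal.ofReal (|m x| ^ (a + 2)) ∂μX ≤ ENNReal.ofReal M) :
    ∫⁻ ω, ∫⁻ x, ENNReal.ofReal
      |m (srt (fun i => (ω i).1) (idx (cnt (fun i => (ω i).1) x))) - m x| ∂μX ∂(PP μX μδ N) ≤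
    2 * ((N + 1 : ℕ) : ℝ≥0∞)⁻¹ * ENNReal.ofReal (2 * T) +
      2 * (ENNReal.ofReal (T ^ (-(a+1))) * ENNReal.ofReal M) := by
  have hmm : Measurable m := hm.measurable
  let H : Set (ℝ × ℝ) := {q | T < q.1 ∧ q.1 ≤ m q.2} ∪ {q | m q.2 < q.1 ∧ q.1 < -T}
  have hH : MeasurableSet H := by
    have hmq : Measurable fun q : ℝ × ℝ => m q.2 := hmm.comp measurable_snd
    refine MeasurableSet.union ?_ ?_
    · exact (measurableSet_lt measurable_const measurable_fst).inter
        (measurableSet_le measurable_fst hmq)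
    · exact (measurableSet_lt hmq measurable_fst).inter
        (measurableSet_lt measurable_fst measurable_const)
  have hHm : Measurable (H.indicator (1 : ℝ × ℝ → ℝ≥0∞)) := measurable_one.indicator hH
  calc _ ≤ ∫⁻ ω, ∫⁻ x, ∫⁻ t, (EV m N).indicator 1 ((ω, x), t) ∂volume ∂μX ∂(PP μX μδ N) := by
        refine lintegral_mono fun ω => lintegral_mono fun x => ?_
        exact diff_le m hm N ω x
    _ = ∫⁻ t, ∫⁻ x, ∫⁻ ω, (EV m N).indicator 1 ((ω, x), t) ∂(PP μX μδ N) ∂μX := by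
        exact triple_swap _ _ _ _ (measurable_one.indicator (EV_meas m hmm N))
    _ ≤ ∫⁻ t, ((Icc (-T) T).indicator (fun _ => 2 * ((N + 1 : ℕ) : ℝ≥0∞)⁻¹) t +
          2 * ∫⁻ x, H.indicator 1 (t, x) ∂μX) := by
        refine lintegral_mono fun t => (J_bound μX μδ m hmm N t).trans ?_
        by_cases h1 : T < t
        · refine le_trans ?_ le_add_self
          gcongr
          refine (min_le_right _ _).trans ((min_le_right _ _).trans ?_)
          rw [← lintegral_indicator_one (measurableSet_le measurable_const hmm)]
          refine lintegral_mono fun x => ?_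
          apply ind_le
          intro hx
          exact Or.inl ⟨h1, hx⟩
        · by_cases h2 : t < -T
          · refine le_trans ?_ le_add_self
            gcongr
            refine (min_le_right _ _).trans ((min_le_left _ _).trans ?_)
            rw [← lintegral_indicator_one (measurableSet_lt hmm measurable_const)]
            refine lintegral_mono fun x => ?_
            apply ind_le
            intro hx
            exact Or.inr ⟨hx, h2⟩
          · refine le_trans ?_ le_self_add
            have ht : t ∈ Icc (-T) T := ⟨not_lt.1 h2, not_lt.1 h1⟩
            rw [Set.indicator_of_mem ht]
            gcongr
            exact min_le_left _ _
    _ = 2 * ((N + 1 : ℕ) : ℝ≥0∞)⁻¹ * ENNReal.ofReal (2 * T) +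
          2 * ∫⁻ x, ∫⁻ t, H.indicator 1 (t, x) ∂volume ∂μX := by
        rw [lintegral_add_left (measurable_const.indicator measurableSet_Icc),
          lintegral_indicator measurableSet_Icc, setLIntegral_const, Real.volume_Icc,
          lintegral_const_mul' _ _ (by simp)]
        congr 2
        · congr 1; ring
        · exact lintegral_lintegral_swap (f := fun t x => H.indicator (1 : ℝ × ℝ → ℝ≥0∞) (t, x))
            hHm.aemeasurable
    _ ≤ _ := by
        gcongr
        calc ∫⁻ x, ∫⁻ t, H.indicator 1 (t, x) ∂volume ∂μX
            ≤ ∫⁻ x, ENNReal.ofReal (T ^ (-(a+1))) * ENNReal.ofReal (|m x| ^ (a+2)) ∂μX := by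
              refine lintegral_mono fun x => le_trans ?_ (tail_pt a T (m x) ha hT)
              have hms : MeasurableSet {t : ℝ | (t, x) ∈ H} :=
                (by fun_prop : Measurable fun t : ℝ => (t, x)) hH
              have e1 : ∫⁻ t, H.indicator 1 (t, x) ∂volume = volume {t : ℝ | (t, x) ∈ H} := by
                rw [← lintegral_indicator_one hms]
                rfl
              rw [e1, ← Real.volume_Ioc, ← Real.volume_Ioo]
              refine le_trans (measure_mono ?_) (measure_union_le _ _)
              rintro t (h | h)
              · exact Or.inl h
              · exact Or.inr h
          _ = _ := lintegral_const_mul' _ _ (by simp)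
          _ ≤ _ := by gcongr

lemma amgm (r w s : ℝ≥0∞) (hs : s ≠ 0) (hs' : s ≠ ⊤) : r * w ≤ s * (w * w) + s⁻¹ * (r * r) := by
  rcases le_total r (s * w) with h | h
  · refine le_trans ?_ le_self_add
    calc r * w ≤ s * w * w := by gcongr
      _ = _ := mul_assoc _ _ _
  · refine le_trans ?_ le_add_self
    calc r * w = r * (s⁻¹ * (s * w)) := by
          rw [← mul_assoc s⁻¹, ENNReal.inv_mul_cancel hs hs', one_mul]
      _ ≤ r * (s⁻¹ * r) := by gcongr
      _ = _ := by ring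

lemma lint_cnt {N : ℕ} (μ : Measure ℝ) (X : Fin (N+1) → ℝ) (g : Fin (N+2) → ℝ≥0∞) :
    ∫⁻ x, g (cnt X x) ∂μ = ∑ j, g j * μ {x | cnt X x = j} := by
  have hc : Measurable (cnt X) := cnt_meas.comp (f := fun x : ℝ => (X, x)) (by fun_prop)
  rw [← lintegral_map (f := g) (measurable_of_countable g) hc, lintegral_fintype]
  refine Finset.sum_congr rfl fun j _ => ?_
  rw [Measure.map_apply hc (measurableSet_singleton j)]
  rfl

/-- no sample in the gap -/
def GP (N : ℕ) : Set (((Fin (N+1) → ℝ × ℝ) × ℝ) × ℝ) :=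
  {q | q.1.2 < q.2 ∧ ∀ i, ¬ ((q.1.1 i).1 < q.2 ∧ q.1.2 ≤ (q.1.1 i).1)}

lemma GP_meas (N : ℕ) : MeasurableSet (GP N) := by
  refine MeasurableSet.inter (measurableSet_lt
    (f := fun q : ((Fin (N+1) → ℝ × ℝ) × ℝ) × ℝ => q.1.2) (g := fun q => q.2)
    (by fun_prop) (by fun_prop)) ?_
  refine (MeasurableSet.iInter fun i => ((measurableSet_lt
    (f := fun q : ((Fin (N+1) → ℝ × ℝ) × ℝ) × ℝ => (q.1.1 i).1)
          (g := fun q => q.2) (by fun_prop) (by fun_prop)).inter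
        (measurableSet_le (f := fun q : ((Fin (N+1) → ℝ × ℝ) × ℝ) × ℝ => q.1.2)
          (g := fun q => (q.1.1 i).1) (by fun_prop) (by fun_prop))).compl).congr ?_
  ext; simp; rfl

lemma GP_int (μX μδ : Measure ℝ) [IsProbabilityMeasure μX] [IsProbabilityMeasure μδ] (N : ℕ) :
    ∫⁻ ω, ∫⁻ x, ∫⁻ x', (GP N).indicator 1 ((ω, x), x') ∂μX ∂μX ∂(PP μX μδ N) ≤
      ((N + 1 : ℕ) : ℝ≥0∞)⁻¹ := by
  rw [triple_swap _ _ _ _ (measurable_one.indicator (GP_meas N))]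
  have : ∀ x', ∫⁻ x, ∫⁻ ω, (GP N).indicator 1 ((ω, x), x') ∂(PP μX μδ N) ∂μX ≤
      ((N + 1 : ℕ) : ℝ≥0∞)⁻¹ := by
    intro x'
    calc _ = ∫⁻ x in Iio x', μX (Iio x' ∩ Ici x)ᶜ ^ (N+1) ∂μX := by
          rw [← lintegral_indicator measurableSet_Iio]
          refine lintegral_congr fun x => ?_
          have hms : MeasurableSet {ω : Fin (N+1) → ℝ × ℝ | ((ω, x), x') ∈ GP N} :=
            (by fun_prop : Measurable fun ω : Fin (N+1) → ℝ × ℝ => ((ω, x), x')) (GP_meas N)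
          have e1 : ∫⁻ ω, (GP N).indicator 1 ((ω, x), x') ∂(PP μX μδ N) =
              PP μX μδ N {ω | ((ω, x), x') ∈ GP N} := by
            rw [← lintegral_indicator_one hms]
            rfl
          rw [e1]
          by_cases hx : x ∈ Iio x'
          · rw [Set.indicator_of_mem hx, ← PP_none μX μδ N]
            congr 1
            ext ω
            have h1 : x < x' := hx
            simp [GP, h1]
          · rw [Set.indicator_of_notMem hx]
            have h1 : ¬ x < x' := hx
            simp [GP, h1]
      _ ≤ ((N + 1 + 1 : ℕ) : ℝ≥0∞)⁻¹ := core_int' (N+1) μX _ measurableSet_Iio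
      _ ≤ _ := by
            apply ENNReal.inv_le_inv.2
            exact_mod_cast Nat.le_succ _
  calc _ ≤ ∫⁻ _, ((N + 1 : ℕ) : ℝ≥0∞)⁻¹ ∂μX := lintegral_mono this
    _ = _ := by simp

lemma wsq (μX : Measure ℝ) [IsProbabilityMeasure μX] [NullSingletonClass μX] (N : ℕ)
    (ω : Fin (N+1) → ℝ × ℝ) :
    ∑ j, μX {x | cnt (fun i => (ω i).1) x = j} * μX {x | cnt (fun i => (ω i).1) x = j} ≤
      2 * ∫⁻ x, ∫⁻ x', (GP N).indicator 1 ((ω, x), x') ∂μX ∂μX := by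
  set X : Fin (N+1) → ℝ := fun i => (ω i).1 with hX
  have hc : Measurable (cnt X) := cnt_meas.comp (f := fun x : ℝ => (X, x)) (by fun_prop)
  have hG : Measurable fun p : ℝ × ℝ => (GP N).indicator (1 : (((Fin (N+1) → ℝ × ℝ) × ℝ) × ℝ) → ℝ≥0∞) ((ω, p.1), p.2) :=
    (measurable_one.indicator (GP_meas N)).comp
      (by fun_prop : Measurable fun p : ℝ × ℝ => ((ω, p.1), p.2))
  have hG' : Measurable fun p : ℝ × ℝ => (GP N).indicator (1 : (((Fin (N+1) → ℝ × ℝ) × ℝ) × ℝ) → ℝ≥0∞) ((ω, p.2), p.1) :=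
    (measurable_one.indicator (GP_meas N)).comp
      (by fun_prop : Measurable fun p : ℝ × ℝ => ((ω, p.2), p.1))
  rw [← lint_cnt μX X (fun j => μX {x | cnt X x = j})]
  calc ∫⁻ x, μX {x' | cnt X x' = cnt X x} ∂μX
      ≤ ∫⁻ x, ((∫⁻ x', (GP N).indicator 1 ((ω, x), x') ∂μX) +
          ∫⁻ x', (GP N).indicator 1 ((ω, x'), x) ∂μX) ∂μX := by
        refine lintegral_mono fun x => ?_
        have hms : MeasurableSet {x' | cnt X x' = cnt X x} := hc (measurableSet_singleton _)
        have hGx : Measurable fun x' : ℝ => (GP N).indicator (1 : (((Fin (N+1) → ℝ × ℝ) × ℝ) × ℝ) → ℝ≥0∞) ((ω, x), x') :=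
          hG.comp (by fun_prop : Measurable fun x' : ℝ => (x, x'))
        rw [← lintegral_indicator_one hms, ← lintegral_add_left hGx]
        refine lintegral_mono_ae ?_
        have hne : ∀ᵐ x' ∂μX, x' ≠ x := by
          rw [ae_iff]; simp
        filter_upwards [hne] with x' hx'
        rcases lt_or_gt_of_ne hx' with h | h
        · refine le_trans ?_ le_add_self
          apply ind_le
          intro he
          have he' : cnt X x' = cnt X x := he
          exact ⟨h, fun i => cnt_eq X x' x he' i⟩
        · refine le_trans ?_ le_self_add
          apply ind_le
          intro he
          have he' : cnt X x' = cnt X x := he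
          exact ⟨h, fun i => cnt_eq X x x' he'.symm i⟩
    _ = _ := by
        rw [lintegral_add_left hG.lintegral_prod_right', two_mul]
        congr 1
        exact lintegral_lintegral_swap
          (f := fun x x' => (GP N).indicator (1 : (((Fin (N+1) → ℝ × ℝ) × ℝ) × ℝ) → ℝ≥0∞) ((ω, x'), x)) hG'.aemeasurable

lemma term1 (μX μδ : Measure ℝ) [IsProbabilityMeasure μX] [IsProbabilityMeasure μδ] [NullSingletonClass μX]
    (m : ℝ → ℝ) (hm : Monotone m) (N : ℕ) (s : ℝ) (hs : 0 < s) :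
    ∫⁻ ω, ∫⁻ x, ENNReal.ofReal
      |srt (fun i => m (ω i).1 + s * (ω i).2) (idx (cnt (fun i => (ω i).1) x)) -
        m (srt (fun i => (ω i).1) (idx (cnt (fun i => (ω i).1) x)))| ∂μX ∂(PP μX μδ N) ≤
    2 * ENNReal.ofReal s * (1 + ∫⁻ x, ENNReal.ofReal (x ^ 2) ∂μδ) := by
  set V := ∫⁻ x, ENNReal.ofReal (x ^ 2) ∂μδ with hV
  set c : ℝ≥0∞ := ((N + 1 : ℕ) : ℝ≥0∞) with hc
  have hc0 : c ≠ 0 := by simp [hc]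
  have hct : c ≠ ⊤ := by simp [hc]
  set S : ℝ≥0∞ := c * ENNReal.ofReal s with hS
  have hso : ENNReal.ofReal s ≠ 0 := by simpa using hs
  have hS0 : S ≠ 0 := mul_ne_zero hc0 hso
  have hSt : S ≠ ⊤ := ENNReal.mul_ne_top hct (by simp)
  have hpt : ∀ ω : Fin (N+1) → ℝ × ℝ, ∫⁻ x, ENNReal.ofReal
      |srt (fun i => m (ω i).1 + s * (ω i).2) (idx (cnt (fun i => (ω i).1) x)) -
        m (srt (fun i => (ω i).1) (idx (cnt (fun i => (ω i).1) x)))| ∂μX ≤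
      S * (2 * ∫⁻ x, ∫⁻ x', (GP N).indicator 1 ((ω, x), x') ∂μX ∂μX) +
      S⁻¹ * (2 * (ENNReal.ofReal (s^2) * ∑ i, ENNReal.ofReal ((ω i).2 ^ 2))) := by
    intro ω
    set X : Fin (N+1) → ℝ := fun i => (ω i).1 with hX
    set Y : Fin (N+1) → ℝ := fun i => m (ω i).1 + s * (ω i).2 with hY
    let D : Fin (N+1) → ℝ := fun j => srt Y j - m (srt X j)
    have h1 := lint_cnt μX X (fun j => ENNReal.ofReal |D (idx j)|)
    refine (le_of_eq h1).trans ?_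
    refine (Finset.sum_le_sum fun j _ => amgm _ _ S hS0 hSt).trans ?_
    rw [Finset.sum_add_distrib, ← Finset.mul_sum, ← Finset.mul_sum]
    refine add_le_add ?_ ?_
    · gcongr
      exact wsq μX N ω
    · gcongr
      have e : ∀ d : ℝ, ENNReal.ofReal |d| * ENNReal.ofReal |d| = ENNReal.ofReal (d^2) := by
        intro d
        rw [← ENNReal.ofReal_mul (abs_nonneg _), abs_mul_abs_self, sq]
      simp only [e]
      have hsum : ∑ j : Fin (N+1), ENNReal.ofReal (D j ^ 2) ≤
          ENNReal.ofReal (s^2) * ∑ i, ENNReal.ofReal ((ω i).2 ^ 2) := by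
        rw [← ENNReal.ofReal_sum_of_nonneg (fun i _ => sq_nonneg _),
          ← ENNReal.ofReal_sum_of_nonneg (fun i _ => sq_nonneg _),
          ← ENNReal.ofReal_mul (sq_nonneg _)]
        apply ENNReal.ofReal_le_ofReal
        refine (sort_l2 m hm X Y).trans (le_of_eq ?_)
        rw [Finset.mul_sum]
        refine Finset.sum_congr rfl fun i _ => ?_
        simp only [hX, hY]
        ring
      rw [Fin.sum_univ_castSucc, two_mul]
      have hid : ∀ j : Fin (N+1), idx j.castSucc = j := by
        intro j
        apply Fin.ext
        show min j.1 N = j.1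
        omega
      simp only [hid]
      refine add_le_add hsum (le_trans ?_ hsum)
      exact Finset.single_le_sum (f := fun j => ENNReal.ofReal (D j ^ 2))
        (fun _ _ => zero_le) (Finset.mem_univ (idx (Fin.last (N+1))))
  have hδ : ∫⁻ ω, ∑ i, ENNReal.ofReal ((ω i).2 ^ 2) ∂(PP μX μδ N) = c * V := by
    rw [lintegral_finsetSum _ (fun i _ => by fun_prop)]
    have : ∀ i : Fin (N+1), ∫⁻ ω, ENNReal.ofReal ((ω i).2 ^ 2) ∂(PP μX μδ N) = V := by
      intro i
      have h1 := (measurePreserving_eval (fun _ : Fin (N+1) => μX.prod μδ) i)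
      have h2 := (measurePreserving_snd (μ := μX) (ν := μδ)).comp h1
      have h3 := h2.lintegral_comp (f := fun x : ℝ => ENNReal.ofReal (x ^ 2)) (by fun_prop)
      exact h3
    simp [this, hc]
  have hGPm : Measurable fun ω : Fin (N+1) → ℝ × ℝ =>
      ∫⁻ x, ∫⁻ x', (GP N).indicator (1 : (((Fin (N+1) → ℝ × ℝ) × ℝ) × ℝ) → ℝ≥0∞) ((ω, x), x') ∂μX ∂μX := by
    have h1 : Measurable fun z : (Fin (N+1) → ℝ × ℝ) × ℝ =>
        ∫⁻ x', (GP N).indicator (1 : (((Fin (N+1) → ℝ × ℝ) × ℝ) × ℝ) → ℝ≥0∞) (z, x') ∂μX :=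
      (measurable_one.indicator (GP_meas N)).lintegral_prod_right'
    exact h1.lintegral_prod_right'
  refine (lintegral_mono hpt).trans ?_
  rw [lintegral_add_left ((hGPm.const_mul 2).const_mul S),
    lintegral_const_mul' _ _ hSt, lintegral_const_mul' _ _ (by simp),
    lintegral_const_mul' _ _ (by simp [hS0]), lintegral_const_mul' _ _ (by simp),
    lintegral_const_mul' _ _ (by simp), hδ, mul_add, mul_one]
  refine add_le_add ?_ (le_of_eq ?_)
  · calc _ ≤ S * (2 * c⁻¹) := by gcongr; exact GP_int μX μδ N
      _ = (c * c⁻¹) * (2 * ENNReal.ofReal s) := by rw [hS]; ring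
      _ = _ := by rw [ENNReal.mul_inv_cancel hc0 hct, one_mul]
  · have : ENNReal.ofReal (s^2) = ENNReal.ofReal s * ENNReal.ofReal s := by
      rw [← ENNReal.ofReal_mul hs.le, sq]
    rw [this]
    calc _ = (S⁻¹ * S) * (2 * ENNReal.ofReal s * V) := by rw [hS]; ring
      _ = _ := by rw [ENNReal.inv_mul_cancel hS0 hSt, one_mul]

lemma risk_bound (μX μδ : Measure ℝ) [IsProbabilityMeasure μX] [IsProbabilityMeasure μδ]
    [NullSingletonClass μX] (hXsupp : μX (Icc 0 1) = 1) (N : ℕ) (s : ℝ) (hs : 0 < s)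
    (a M T : ℝ) (ha : 0 < a) (hT : 0 < T) (m : ℝ → ℝ) (hm : m ∈ MM μX M a) :
    popRisk μX (shuffledLaw μX μδ s m (N+1)) est m ≤
      2 * ENNReal.ofReal s * (1 + ∫⁻ x, ENNReal.ofReal (x ^ 2) ∂μδ) +
      (2 * ((N + 1 : ℕ) : ℝ≥0∞)⁻¹ * ENNReal.ofReal (2 * T) +
      2 * (ENNReal.ofReal (T ^ (-(a+1))) * ENNReal.ofReal M)) := by
  let m' : ℝ → ℝ := fun x => m (max 0 (min 1 x))
  have hmono : Monotone m' := by
    intro x y h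
    refine hm.1.1 ⟨le_max_left _ _, max_le zero_le_one (min_le_left _ _)⟩
      ⟨le_max_left _ _, max_le zero_le_one (min_le_left _ _)⟩ ?_
    exact max_le_max le_rfl (min_le_min le_rfl h)
  have heq : ∀ x ∈ Icc (0:ℝ) 1, m x = m' x := by
    intro x hx
    simp only [m']
    rw [min_eq_right hx.2, max_eq_right hx.1]
  have hae : ∀ᵐ x ∂μX, x ∈ Icc (0:ℝ) 1 := by
    rw [ae_iff]
    exact (prob_compl_eq_zero_iff measurableSet_Icc).2 hXsupp
  have haeω : ∀ᵐ ω ∂(PP μX μδ N), ∀ i, (ω i).1 ∈ Icc (0:ℝ) 1 := by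
    rw [ae_all_iff]
    intro i
    have h1 := (measurePreserving_eval (fun _ : Fin (N+1) => μX.prod μδ) i)
    have h2 := (measurePreserving_fst (μ := μX) (ν := μδ)).comp h1
    exact h2.quasiMeasurePreserving.ae hae
  have hM' : ∫⁻ x, ENNReal.ofReal (|m' x| ^ (a + 2)) ∂μX ≤ ENNReal.ofReal M := by
    refine le_trans (le_of_eq ?_) hm.2
    refine lintegral_congr_ae ?_
    filter_upwards [hae] with x hx
    rw [heq x hx]
  refine le_trans ?_ (add_le_add (term1 μX μδ m' hmono N s hs)
    (term2 μX μδ m' hmono N a M T ha hT hM'))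
  have hmeas : Measurable fun p : (Fin (N+1) → ℝ × ℝ) × ℝ => ENNReal.ofReal
      |m' (srt (fun i => (p.1 i).1) (idx (cnt (fun i => (p.1 i).1) p.2))) - m' p.2| := by
    have h1 : Measurable fun p : (Fin (N+1) → ℝ × ℝ) × ℝ =>
        srt (fun i => (p.1 i).1) (idx (cnt (fun i => (p.1 i).1) p.2)) :=
      est_meas.comp (by fun_prop : Measurable fun p : (Fin (N+1) → ℝ × ℝ) × ℝ =>
        (((fun i => (p.1 i).1), (fun i => (p.1 i).1)), p.2))
    have h2 := hmono.measurable.comp h1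
    have h3 := hmono.measurable.comp
      (measurable_snd : Measurable fun p : (Fin (N+1) → ℝ × ℝ) × ℝ => p.2)
    exact ENNReal.measurable_ofReal.comp (continuous_abs.measurable.comp (h2.sub h3))
  rw [← lintegral_add_right _ hmeas.lintegral_prod_right']
  unfold popRisk shuffledLaw
  refine (lintegral_map_le _ _).trans ?_
  refine lintegral_mono_ae ?_
  filter_upwards [haeω] with ω hω
  have hmx : Measurable fun x : ℝ => ENNReal.ofReal
      |m' (srt (fun i => (ω i).1) (idx (cnt (fun i => (ω i).1) x))) - m' x| :=
    hmeas.comp (by fun_prop : Measurable fun x : ℝ => (ω, x))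
  rw [← lintegral_add_right _ hmx]
  refine lintegral_mono_ae ?_
  filter_upwards [hae] with x hx
  rw [heq x hx]
  have hY : (fun i => m (ω i).1 + s * (ω i).2) = fun i => m' (ω i).1 + s * (ω i).2 := by
    ext i; rw [heq _ (hω i)]
  simp only [est, hY]
  rw [cnt_perm (fun i => (ω i).1) (Tuple.sort fun i => (ω i).1) x]
  rw [← ENNReal.ofReal_add (abs_nonneg _) (abs_nonneg _)]
  exact ENNReal.ofReal_le_ofReal (abs_sub_le _ _ _)

end Shuf

/-- **Upper bound on the population shuffled minimax risk** (Theorem 4.1, second claim).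
If the error is centered with finite variance and the covariate density is bounded
below by a known `c_X > 0` on its support, then there is a constant `K > 0`, not
depending on `n`, such that for every `n ≥ 1` there is a monotone LCRR estimator whose
maximal population risk over `m ∈ M(M,a)` is at most
`K (σ_n + n^{-(a+1)/(a+2)} log n)`. -/
theorem shuffled_population_minimax_upper_bound
    (σ : ℕ → ℝ) (A : ℝ) (hσpos : ∀ n, 0 < σ n) (hσbdd : ∀ n, σ n ≤ A)
    (a M : ℝ) (ha : 0 < a) (hM : 0 < M)
    (μδ : Measure ℝ) (hδprob : IsProbabilityMeasure μδ)
    (hmean : ∫ x, x ∂μδ = 0)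
    (hvarfin : ∫⁻ x, ENNReal.ofReal (x ^ 2) ∂μδ < ⊤)
    (μX : Measure ℝ) (hXprob : IsProbabilityMeasure μX)
    (hXsupp : μX (Icc 0 1) = 1)
    (fX : ℝ → ℝ) (hfXmeas : Measurable fX)
    (hXdens : μX = volume.withDensity fun x => ENNReal.ofReal (fX x))
    (cX : ℝ) (hcX : 0 < cX)
    (hfXlb : ∀ x ∈ Function.support fX, cX ≤ fX x) :
    ∃ K > 0, ∀ n ≥ 2,
      ∃ mhat : ((Fin n → ℝ) × (Fin n → ℝ)) → ℝ → ℝ,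
        (∀ d, mhat d ∈ LCRR) ∧
        Measurable (fun p : ((Fin n → ℝ) × (Fin n → ℝ)) × ℝ => mhat p.1 p.2) ∧
        ∀ m ∈ MM μX M a,
          popRisk μX (shuffledLaw μX μδ (σ n) m n) mhat m ≤
            ENNReal.ofReal (K * (σ n +
              (n : ℝ) ^ (-((a + 1) / (a + 2))) * Real.log n)) := by
  have hna : NullSingletonClass μX := by
    rw [hXdens]; infer_instance
  set V := (∫⁻ x, ENNReal.ofReal (x ^ 2) ∂μδ).toReal with hV
  have hV0 : 0 ≤ V := ENNReal.toReal_nonneg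
  have hVe : ∫⁻ x, ENNReal.ofReal (x ^ 2) ∂μδ = ENNReal.ofReal V :=
    (ENNReal.ofReal_toReal hvarfin.ne).symm
  refine ⟨2 * (1 + V) + 8 + 4 * M, by positivity, ?_⟩
  intro n hn
  obtain ⟨N, rfl⟩ : ∃ N, n = N + 1 := ⟨n - 1, by omega⟩
  refine ⟨Shuf.est, Shuf.est_lcrr, Shuf.est_meas, fun m hm => ?_⟩
  set r : ℝ := ((N + 1 : ℕ) : ℝ) with hr
  have hr2 : 2 ≤ r := by rw [hr]; exact_mod_cast hn
  have hr0 : 0 < r := by linarith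
  set T : ℝ := r ^ (1 / (a + 2)) with hT
  have hT0 : 0 < T := Real.rpow_pos_of_pos hr0 _
  set E : ℝ := r ^ (-((a + 1) / (a + 2))) with hE
  have hE0 : 0 < E := Real.rpow_pos_of_pos hr0 _
  have ha2 : a + 2 ≠ 0 := by positivity
  have e1 : T ^ (-(a + 1)) = E := by
    rw [hT, hE, ← Real.rpow_mul hr0.le]
    congr 1; ring
  have e2 : r⁻¹ * T = E := by
    rw [hT, hE, ← Real.rpow_neg_one, ← Real.rpow_add hr0]
    congr 1; field_simp; ring
  have hs := hσpos (N + 1)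
  refine (Shuf.risk_bound μX μδ hXsupp N (σ (N+1)) hs a M T ha hT0 m hm).trans ?_
  have hinv : ((N + 1 : ℕ) : ℝ≥0∞)⁻¹ = ENNReal.ofReal r⁻¹ := by
    rw [ENNReal.ofReal_inv_of_pos hr0, hr, ENNReal.ofReal_natCast]
  have h2 : (2 : ℝ≥0∞) = ENNReal.ofReal 2 := by simp
  have h1 : (1 : ℝ≥0∞) = ENNReal.ofReal 1 := by simp
  rw [hVe, hinv, h2, h1, e1, ← ENNReal.ofReal_add (by norm_num) hV0,
    ← ENNReal.ofReal_mul (by positivity), ← ENNReal.ofReal_mul (by positivity),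
    ← ENNReal.ofReal_mul (by positivity), ← ENNReal.ofReal_mul (by positivity),
    ← ENNReal.ofReal_mul (by positivity), ← ENNReal.ofReal_mul (by positivity),
    ← ENNReal.ofReal_add (by positivity) (by positivity),
    ← ENNReal.ofReal_add (by positivity) (by positivity)]
  apply ENNReal.ofReal_le_ofReal
  have hlog : 1 / 2 ≤ Real.log r := by
    have h3 : Real.log 2 ≤ Real.log r := Real.log_le_log (by norm_num) hr2
    have := Real.log_two_gt_d9
    linarith
  have e3 : 2 * r⁻¹ * (2 * T) = 4 * E := by rw [← e2]; ring
  rw [e3]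
  have hEl : E ≤ 2 * (E * Real.log r) := by nlinarith
  have hEl0 : 0 ≤ E * Real.log r := by nlinarith
  have hME : M * E ≤ M * (2 * (E * Real.log r)) := by gcongr
  have h5 : 0 ≤ (2 * (1 + V)) * (E * Real.log r) := by positivity
  have h6 : 0 ≤ (8 + 4 * M) * σ (N+1) := by positivity
  nlinarith
end
end

section
/- Consider the noiseless shuffled regression model, i.e. Y_i = m(X_i) for m ∈ M(M,a), where X₁,…,X_n are i.i.d. uniform on [0,1] (more generally μ_X continuous) and one observes Y₁,…,Y_n together with the order statistics X_(1) ≤ … ≤ X_(n). Then for every ε > 0 and every M, a > 0 there exists a constant C > 0 such that for all n ≥ 2, the population shuffled minimax risk satisfies R_S(M,a,n,μ_X) ≥ C·n^{−(a+1)/(a+2)}·(log n)^{−(1+ε)/(a+2)}. -/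
open MeasureTheory ProbabilityTheory Filter Set
open scoped ENNReal NNReal Classical

noncomputable section

/-- The law of the observations in the noiseless shuffled regression model: from i.i.d.
`Xᵢ ~ μ_X`, one observes `(Y₁,…,Yₙ)` with `Yᵢ = m(Xᵢ)` together with the order
statistics `X₍₁₎ ≤ … ≤ X₍ₙ₎`. -/
def noiselessShuffledLaw (μX : Measure ℝ) (m : ℝ → ℝ) (n : ℕ) :
    Measure ((Fin n → ℝ) × (Fin n → ℝ)) :=
  (Measure.pi fun _ : Fin n => μX).map fun x =>
    (fun i => m (x i), fun j => x (Tuple.sort x j))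

theorem aux_measurable_sort (n : ℕ) :
    Measurable (fun x : Fin n → ℝ => fun j => x (Tuple.sort x j)) := by
  have hset : ∀ σ : Equiv.Perm (Fin n), MeasurableSet {x : Fin n → ℝ | Tuple.sort x = σ} := by
    intro σ
    have : {x : Fin n → ℝ | Tuple.sort x = σ} =
        (⋂ i : Fin n, ⋂ j : Fin n, ⋂ _ : i ≤ j, {x : Fin n → ℝ | x (σ i) ≤ x (σ j)}) ∩
        (⋂ i : Fin n, ⋂ j : Fin n, ⋂ _ : i < j,
          {x : Fin n → ℝ | x (σ i) = x (σ j) → σ i < σ j}) := by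
      ext x
      simp only [mem_inter_iff, mem_iInter]
      exact eq_comm.trans Tuple.eq_sort_iff
    rw [this]
    refine MeasurableSet.inter ?_ ?_
    · refine MeasurableSet.iInter fun i => MeasurableSet.iInter fun j => MeasurableSet.iInter fun _ => ?_
      exact measurableSet_le (measurable_pi_apply _) (measurable_pi_apply _)
    · refine MeasurableSet.iInter fun i => MeasurableSet.iInter fun j => MeasurableSet.iInter fun _ => ?_
      by_cases h : σ i < σ j
      · simp [h]
      · simp only [h, imp_false]
        exact (measurableSet_eq_fun (f := fun x : Fin n → ℝ => x (σ i))
          (g := fun x : Fin n → ℝ => x (σ j)) (measurable_pi_apply _) (measurable_pi_apply _)).compl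
  intro s hs
  have : (fun x : Fin n → ℝ => fun j => x (Tuple.sort x j)) ⁻¹' s =
      ⋃ σ : Equiv.Perm (Fin n), {x : Fin n → ℝ | Tuple.sort x = σ} ∩
        (fun x : Fin n → ℝ => fun j => x (σ j)) ⁻¹' s := by
    ext x
    simp
  rw [this]
  refine MeasurableSet.iUnion fun σ => (hset σ).inter ?_
  exact (measurable_pi_lambda _ fun j => measurable_pi_apply _) hs

theorem aux_measurable_obs (n : ℕ) (m : ℝ → ℝ) (hm : Measurable m) :
    Measurable (fun x : Fin n → ℝ =>
      ((fun i => m (x i), fun j => x (Tuple.sort x j)) : (Fin n → ℝ) × (Fin n → ℝ))) :=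
  (measurable_pi_lambda _ fun i => hm.comp (measurable_pi_apply i)).prodMk (aux_measurable_sort n)

theorem aux_quantile (μX : Measure ℝ) [IsProbabilityMeasure μX] (hXcont : ∀ x : ℝ, μX {x} = 0)
    (p : ℝ) (hp0 : 0 < p) (hp1 : p < 1) : ∃ t : ℝ, μX (Iic t) = ENNReal.ofReal p := by
  have hc : Continuous (cdf μX) := by
    rw [continuous_iff_continuousAt]
    intro x
    have h := (cdf μX).measure_singleton x
    rw [measure_cdf, hXcont] at h
    have h1 : Function.leftLim (cdf μX) x = cdf μX x := by
      have h2 := ENNReal.ofReal_eq_zero.1 h.symm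
      have h3 := (monotone_cdf μX).leftLim_le (le_refl x)
      linarith
    rw [(monotone_cdf μX).continuousAt_iff_leftLim_eq_rightLim, h1]
    exact ((cdf μX).rightLim_eq x).symm
  have hlo : ∃ x, cdf μX x ≤ p :=
    (((tendsto_cdf_atBot μX).eventually (gt_mem_nhds hp0)).exists).imp fun _ h => le_of_lt h
  have hhi : ∃ x, p ≤ cdf μX x :=
    (((tendsto_cdf_atTop μX).eventually (lt_mem_nhds hp1)).exists).imp fun _ h => le_of_lt h
  obtain ⟨t, ht⟩ := mem_range_of_exists_le_of_exists_ge hc hlo hhi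
  exact ⟨t, by rw [← ofReal_cdf, ht]⟩

def stepFn (t h : ℝ) : ℝ → ℝ := fun x => if x ≤ t then 0 else h

theorem stepFn_measurable (t h : ℝ) : Measurable (stepFn t h) :=
  Measurable.ite measurableSet_Iic measurable_const measurable_const

theorem stepFn_LCRR (t h : ℝ) (hh : 0 ≤ h) : stepFn t h ∈ LCRR := by
  refine ⟨?_, ?_, ?_⟩
  · intro x _ y _ hxy
    unfold stepFn
    split_ifs <;> linarith
  · intro x _
    by_cases hx : x ≤ t
    · refine tendsto_const_nhds.congr' ?_
      filter_upwards [self_mem_nhdsWithin] with y hy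
      have : y ≤ t := le_trans (le_of_lt hy) hx
      simp [stepFn, hx, this]
    · refine tendsto_const_nhds.congr' ?_
      filter_upwards [mem_nhdsWithin_of_mem_nhds (lt_mem_nhds (not_le.1 hx))] with y hy
      simp [stepFn, hx, not_le.2 hy]
  · intro x _
    by_cases hx : x < t
    · refine ⟨0, tendsto_const_nhds.congr' ?_⟩
      filter_upwards [mem_nhdsWithin_of_mem_nhds (gt_mem_nhds hx)] with y hy
      simp [stepFn, le_of_lt hy]
    · refine ⟨h, tendsto_const_nhds.congr' ?_⟩
      filter_upwards [self_mem_nhdsWithin] with y hy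
      have : t < y := lt_of_le_of_lt (not_lt.1 hx) hy
      simp [stepFn, not_le.2 this]

theorem aux_lintegral_step (μX : Measure ℝ) (t : ℝ) (φ : ℝ → ℝ≥0∞) (h : ℝ) (h0 : φ 0 = 0) :
    ∫⁻ x, φ (stepFn t h x) ∂μX = φ h * μX (Ioi t) := by
  rw [← lintegral_indicator_const measurableSet_Ioi]
  congr 1
  ext x
  by_cases hx : x ≤ t
  · simp [stepFn, hx, h0]
  · simp [stepFn, hx, not_le.1 hx]

theorem aux_two_point (μX : Measure ℝ) [IsProbabilityMeasure μX] (n : ℕ) (t h : ℝ) (hh : 0 ≤ h)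
    (mhat : ((Fin n → ℝ) × (Fin n → ℝ)) → ℝ → ℝ)
    (hmeas : Measurable (fun p : ((Fin n → ℝ) × (Fin n → ℝ)) × ℝ => mhat p.1 p.2)) :
    ENNReal.ofReal h * μX (Ioi t) * μX (Iic t) ^ n ≤
      popRisk μX (noiselessShuffledLaw μX (stepFn t 0) n) mhat (stepFn t 0) +
      popRisk μX (noiselessShuffledLaw μX (stepFn t h) n) mhat (stepFn t h) := by
  have hG : ∀ k : ℝ, Measurable (fun d => ∫⁻ x, ENNReal.ofReal |mhat d x - stepFn t k x| ∂μX) := by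
    intro k
    refine Measurable.lintegral_prod_right' (f := fun p : ((Fin n → ℝ) × (Fin n → ℝ)) × ℝ =>
      ENNReal.ofReal |mhat p.1 p.2 - stepFn t k p.2|) ?_
    have : Measurable (fun p : ((Fin n → ℝ) × (Fin n → ℝ)) × ℝ => stepFn t k p.2) :=
      (stepFn_measurable t k).comp measurable_snd
    exact (hmeas.sub this).abs.ennreal_ofReal
  have hT := fun k => aux_measurable_obs n (stepFn t k) (stepFn_measurable t k)
  unfold popRisk noiselessShuffledLaw
  rw [lintegral_map (hG 0) (hT 0), lintegral_map (hG h) (hT h)]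
  have hcomp := (hG 0).comp (hT 0)
  simp only [Function.comp_def] at hcomp
  rw [← lintegral_add_left hcomp]
  set A : Set (Fin n → ℝ) := Set.univ.pi fun _ => Iic t with hA
  have hAm : MeasurableSet A := MeasurableSet.univ_pi fun _ => measurableSet_Iic
  have hPA : (Measure.pi fun _ : Fin n => μX) A = μX (Iic t) ^ n := by
    rw [hA, Measure.pi_pi]; simp
  rw [← hPA, ← setLIntegral_const]
  refine le_trans (setLIntegral_mono' hAm ?_) (setLIntegral_le_lintegral A _)
  intro x hx
  have hx' : ∀ i, x i ≤ t := fun i => hx i (mem_univ i)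
  have he : (fun i => stepFn t h (x i)) = fun i => stepFn t 0 (x i) := by
    ext i; simp [stepFn, hx' i]
  rw [he]
  generalize ((fun i => stepFn t 0 (x i), fun j => x (Tuple.sort x j)) :
    (Fin n → ℝ) × (Fin n → ℝ)) = d
  have hd : Measurable (mhat d) := hmeas.comp measurable_prodMk_left
  have hd' : Measurable (fun y => ENNReal.ofReal |mhat d y - stepFn t 0 y|) :=
    (hd.sub (stepFn_measurable t 0)).abs.ennreal_ofReal
  rw [← lintegral_add_left hd']
  have hs := aux_lintegral_step μX t (fun y => ENNReal.ofReal |y|) h (by simp)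
  simp only [abs_of_nonneg hh] at hs
  rw [← hs]
  refine lintegral_mono fun y => ?_
  dsimp only
  rw [← ENNReal.ofReal_add (abs_nonneg _) (abs_nonneg _)]
  refine ENNReal.ofReal_le_ofReal ?_
  have h0 : stepFn t 0 y = 0 := by simp [stepFn]
  rw [h0, sub_zero]
  have := abs_sub_abs_le_abs_sub (stepFn t h y) (mhat d y)
  rw [abs_sub_comm] at this
  linarith

/-- **Minimax lower bound for noiseless shuffled regression** (Theorem 4.2).
In the noiseless shuffled regression model with a continuous covariate distribution,
for every `ε > 0` and `M, a > 0` there is `C > 0` such that for all `n ≥ 2` and every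
monotone LCRR estimator, the maximal population risk over `m ∈ M(M,a)` is at least
`C n^{-(a+1)/(a+2)} (log n)^{-(1+ε)/(a+2)}`. -/
theorem shuffled_noiseless_minimax_lower_bound
    (μX : Measure ℝ) (hXprob : IsProbabilityMeasure μX)
    (hXsupp : μX (Icc 0 1) = 1) (hXcont : ∀ x : ℝ, μX {x} = 0)
    (ε M a : ℝ) (hε : 0 < ε) (hM : 0 < M) (ha : 0 < a) :
    ∃ C > 0, ∀ n ≥ 2,
      ∀ mhat : ((Fin n → ℝ) × (Fin n → ℝ)) → ℝ → ℝ,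
        (∀ d, mhat d ∈ LCRR) →
        Measurable (fun p : ((Fin n → ℝ) × (Fin n → ℝ)) × ℝ => mhat p.1 p.2) →
        ENNReal.ofReal (C * (n : ℝ) ^ (-((a + 1) / (a + 2))) *
            Real.log n ^ (-((1 + ε) / (a + 2)))) ≤
          ⨆ m ∈ MM μX M a, popRisk μX (noiselessShuffledLaw μX m n) mhat m := by
  have ha2 : 0 < a + 2 := by linarith
  have hl2 : 0 < Real.log 2 := Real.log_pos (by norm_num)
  refine ⟨M ^ (1 / (a + 2)) / 8 * Real.log 2 ^ ((1 + ε) / (a + 2)), by positivity, ?_⟩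
  intro n hn mhat _ hmeas
  have hn' : (2 : ℝ) ≤ n := by exact_mod_cast hn
  have hn0 : (0 : ℝ) < n := by linarith
  set q : ℝ := 1 / (2 * n) with hq
  have hq0 : 0 < q := by positivity
  have hqn : n * q = 1 / 2 := by rw [hq]; field_simp
  have hq1 : q < 1 := by nlinarith
  obtain ⟨t, ht⟩ := aux_quantile μX hXcont (1 - q) (by linarith) (by linarith)
  have ht' : μX (Ioi t) = ENNReal.ofReal q := by
    rw [← compl_Iic, prob_compl_eq_one_sub measurableSet_Iic, ht, ← ENNReal.ofReal_one,
      ← ENNReal.ofReal_sub _ (by linarith)]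
    congr 1; ring
  set h : ℝ := (M * n) ^ (1 / (a + 2)) with hh
  have hh0 : 0 ≤ h := by positivity
  have hmem : ∀ k, 0 ≤ k → k ≤ h → stepFn t k ∈ MM μX M a := by
    intro k hk hkh
    refine ⟨stepFn_LCRR t k hk, ?_⟩
    rw [aux_lintegral_step μX t (fun y => ENNReal.ofReal (|y| ^ (a + 2))) k
      (by simp [Real.zero_rpow ha2.ne']), ht', ← ENNReal.ofReal_mul (by positivity)]
    refine ENNReal.ofReal_le_ofReal ?_
    rw [abs_of_nonneg hk]
    have h1 : k ^ (a + 2) ≤ M * n := by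
      calc k ^ (a + 2) ≤ h ^ (a + 2) := Real.rpow_le_rpow hk hkh ha2.le
        _ = M * n := by
          rw [hh, ← Real.rpow_mul (by positivity), one_div_mul_cancel ha2.ne', Real.rpow_one]
    calc k ^ (a + 2) * q ≤ M * n * q := by gcongr
      _ = M * (1 / 2) := by rw [mul_assoc, hqn]
      _ ≤ M := by linarith
  have h2 := aux_two_point μX n t h hh0 mhat hmeas
  set S := ⨆ m ∈ MM μX M a, popRisk μX (noiselessShuffledLaw μX m n) mhat m with hS
  have hle : ∀ k, 0 ≤ k → k ≤ h →
      popRisk μX (noiselessShuffledLaw μX (stepFn t k) n) mhat (stepFn t k) ≤ S := fun k hk hkh =>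
    le_iSup₂ (f := fun m (_ : m ∈ MM μX M a) =>
      popRisk μX (noiselessShuffledLaw μX m n) mhat m) (stepFn t k) (hmem k hk hkh)
  have h3 := h2.trans (add_le_add (hle 0 le_rfl hh0) (hle h hh0 le_rfl))
  rw [ht, ht', ← ENNReal.ofReal_mul hh0, ← ENNReal.ofReal_pow (by linarith),
    ← ENNReal.ofReal_mul (by positivity), ← two_mul] at h3
  have hb : (1 / 2 : ℝ) ≤ (1 - q) ^ n := by
    have := one_add_mul_le_pow (a := -q) (by linarith) n
    rw [← sub_eq_add_neg] at this
    linarith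
  have hlog : Real.log 2 ^ ((1 + ε) / (a + 2)) * Real.log n ^ (-((1 + ε) / (a + 2))) ≤ 1 := by
    have hle : Real.log 2 ≤ Real.log n := Real.log_le_log (by norm_num) hn'
    rw [Real.rpow_neg (by linarith), ← div_eq_mul_inv]
    refine div_le_one_of_le₀ ?_ (Real.rpow_nonneg (by linarith) _)
    exact Real.rpow_le_rpow hl2.le hle (by positivity)
  have hnn : (n : ℝ) ^ (-((a + 1) / (a + 2))) = (n : ℝ) ^ (1 / (a + 2)) / n := by
    rw [← Real.rpow_sub_one hn0.ne']
    congr 1; field_simp; ring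
  have hfin : 2 * (M ^ (1 / (a + 2)) / 8 * Real.log 2 ^ ((1 + ε) / (a + 2)) *
      (n : ℝ) ^ (-((a + 1) / (a + 2))) * Real.log n ^ (-((1 + ε) / (a + 2)))) ≤
      h * q * (1 - q) ^ n := by
    have e1 : h * q = M ^ (1 / (a + 2)) * (n : ℝ) ^ (-((a + 1) / (a + 2))) / 2 := by
      rw [hnn, hh, Real.mul_rpow hM.le hn0.le, hq]; field_simp
    have hB : 0 ≤ h * q := by positivity
    calc _ = (h * q) / 2 * (Real.log 2 ^ ((1 + ε) / (a + 2)) *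
          Real.log n ^ (-((1 + ε) / (a + 2)))) := by rw [e1]; ring
      _ ≤ (h * q) / 2 * 1 := by gcongr
      _ = h * q * (1 / 2) := by ring
      _ ≤ _ := by gcongr
  have h4 := (ENNReal.ofReal_le_ofReal hfin).trans h3
  rw [ENNReal.ofReal_mul (by norm_num), ENNReal.ofReal_ofNat] at h4
  exact (ENNReal.mul_le_mul_iff_right (by norm_num) (by norm_num)).1 h4
end
end
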